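/- Fix p,β∈ℕ+ and d ≥ 17·β^{p+1}·3^p·p + 1. Let Θ be any transformer parameters with the emulation property. Then for every r∈ℕ+ with 17·β^{p+1}·3^p·p ≤ r ≤ d−1, every L ≥ 108β²+3p, and every T ≥ 2(r+1)L: sup_{f∈C_u^β([0,1]^p)} inf_{S>0, H^P∈Q_{U_{d,r+1}}(T,L,S)} ‖f̂_{Θ,H^P,L,p} − f‖_{L^∞([0,1]^p)} ≤ C_1·(r/(C_2·log(8r+8)))^{−2β/p}·((L−3p)/(C_3·log(4L)))^{−2β/p}, where C_1=85(β+1)^p·8^β, C_2=68β^{p+1}·3^p·p, C_3=72β². -/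

import Mathlib

open scoped BigOperators
open Matrix

noncomputable section

namespace PromptTF

/-- The ReLU activation function. -/
def relu (x : ℝ) : ℝ := max x 0

/-- The elementary universal activation function (EUAF). -/
def euaf (x : ℝ) : ℝ :=
  if 0 ≤ x then |x - 2 * (⌊(x + 1) / 2⌋ : ℝ)| else x / (1 + |x|)

/-- Parameters of one transformer layer (attention heads and a feed-forward net). -/
structure TFLayer (D : ℕ) where
  M : ℕ
  Q : Fin M → Matrix (Fin D) (Fin D) ℝ
  K : Fin M → Matrix (Fin D) (Fin D) ℝ
  V : Fin M → Matrix (Fin D) (Fin D) ℝ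
  width : ℕ
  W1 : Matrix (Fin width) (Fin D) ℝ
  W2 : Matrix (Fin D) (Fin width) ℝ

/-- Self-attention layer applied to a list of tokens. -/
def attnOut {D : ℕ} (θ : TFLayer D) (H : List (Fin D → ℝ)) : List (Fin D → ℝ) :=
  H.map fun h => fun i =>
    h i + ∑ m : Fin θ.M,
      (H.map fun h' =>
        relu (dotProduct ((θ.Q m).mulVec h) ((θ.K m).mulVec h')) * ((θ.V m).mulVec h') i).sum

/-- One transformer layer `FFN ∘ Attn`, with feed-forward activation `act`. -/
def layerMap {D : ℕ} (act : ℝ → ℝ) (θ : TFLayer D) (H : List (Fin D → ℝ)) :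
    List (Fin D → ℝ) :=
  (attnOut θ H).map fun h => fun i =>
    h i + (θ.W2.mulVec fun k => act ((θ.W1.mulVec h) k)) i

/-- Multi-layer transformer, all activations ReLU. -/
def tfForward {D : ℕ} (Θ : List (TFLayer D)) (H : List (Fin D → ℝ)) : List (Fin D → ℝ) :=
  Θ.foldl (fun H' θ => layerMap relu θ H') H

/-- Multi-layer transformer whose first feed-forward layer uses the EUAF activation. -/
def tfForwardEUAF {D : ℕ} (Θ : List (TFLayer D)) (H : List (Fin D → ℝ)) :
    List (Fin D → ℝ) :=
  match Θ with
  | [] => H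
  | θ :: rest => rest.foldl (fun H' θ' => layerMap relu θ' H') (layerMap euaf θ H)

/-- Sequential (autoregressive) generation: append the last output column repeatedly. -/
def genTokens {D : ℕ} (forward : List (Fin D → ℝ) → List (Fin D → ℝ))
    (H : List (Fin D → ℝ)) : ℕ → List (Fin D → ℝ)
  | 0 => H
  | v + 1 =>
      genTokens forward H v ++ [(forward (genTokens forward H v)).getLastD (fun _ => 0)]

/-- The token at one-based position `m` in the generated sequence. -/
def tokenAt {D : ℕ} (forward : List (Fin D → ℝ) → List (Fin D → ℝ))
    (H : List (Fin D → ℝ)) (m : ℕ) : Fin D → ℝ :=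
  (genTokens forward H (m - H.length)).getD (m - 1) (fun _ => 0)

/-- A token with word embedding `u`, layer index `w`, position `j` and scale `S`:
`(uᵀ, 0_{3d+4}ᵀ, 1, S, S·w, S·j)ᵀ ∈ ℝ^{4d+8}`. -/
def promptToken (d : ℕ) (u : Fin d → ℝ) (w : ℤ) (j : ℕ) (S : ℝ) : Fin (4 * d + 8) → ℝ :=
  fun i =>
    if h : (i : ℕ) < d then u ⟨i, h⟩
    else if (i : ℕ) = 4 * d + 4 then 1
    else if (i : ℕ) = 4 * d + 5 then S
    else if (i : ℕ) = 4 * d + 6 then S * w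
    else if (i : ℕ) = 4 * d + 7 then S * j
    else 0

/-- First `d` coordinates of a token. -/
def firstd (d : ℕ) (h : Fin (4 * d + 8) → ℝ) : Fin d → ℝ :=
  fun k => h (Fin.castLE (by omega) k)

/-- Initial input: `T` prompt tokens followed by `N` data tokens. -/
def initialInput (d T N : ℕ) (u : Fin T → Fin d → ℝ) (w : Fin T → ℕ) (S : ℝ)
    (z : Fin N → Fin d → ℝ) : List (Fin (4 * d + 8) → ℝ) :=
  ((List.finRange T).map fun j => promptToken d (u j) (w j) ((j : ℕ) + 1) S)
    ++ ((List.finRange N).map fun i => promptToken d (z i) 0 (T + (i : ℕ) + 1) S)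

/-- The closed Euclidean ball of radius `B` in `ℝ^d`. -/
def eball (d : ℕ) (B : ℝ) : Set (Fin d → ℝ) :=
  {v | Real.sqrt (∑ k, v k ^ 2) ≤ B}

/-- Data of a valid prompt in `P_U(T, L, S)`: word embeddings in `U`,
layer indices in `{1, …, 2L}`. -/
def ValidPrompt {d : ℕ} (U : Set (Fin d → ℝ)) (T L : ℕ)
    (u : Fin T → Fin d → ℝ) (w : Fin T → ℕ) : Prop :=
  (∀ j, u j ∈ U) ∧ ∀ j, 1 ≤ w j ∧ w j ≤ 2 * L

/-- The virtual weight matrix `W^P_ℓ` (without the first-layer correction term). -/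
def WPmat {d T : ℕ} (u : Fin T → Fin d → ℝ) (w : Fin T → ℕ) (ℓ : ℕ) :
    Matrix (Fin d) (Fin d) ℝ :=
  ∑ j : Fin T,
    if h : (j : ℕ) + 1 < T then
      (if w j = 2 * ℓ - 1 ∧ w ⟨(j : ℕ) + 1, h⟩ = 2 * ℓ then
        vecMulVec (u j) (u ⟨(j : ℕ) + 1, h⟩) else 0)
    else 0

/-- The first-layer correction term `(h_T)_{1:d} 1{w_T=1} Σ_{j'} (h_{j'})_{1:d}ᵀ 1{w_{j'}=1}`. -/
def WPcorr {d T : ℕ} (u : Fin T → Fin d → ℝ) (w : Fin T → ℕ) :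
    Matrix (Fin d) (Fin d) ℝ :=
  if hT : 0 < T then
    (if w ⟨T - 1, by omega⟩ = 1 then
      vecMulVec (u ⟨T - 1, by omega⟩) (∑ j : Fin T, if w j = 1 then u j else 0)
    else 0)
  else 0

/-- The virtual first-layer weight matrix `W^P_{1,i}`; `first` indicates `i = 1`. -/
def WPone {d T : ℕ} (u : Fin T → Fin d → ℝ) (w : Fin T → ℕ) (first : Bool) :
    Matrix (Fin d) (Fin d) ℝ :=
  WPmat u w 1 + if first then WPcorr u w else 0

/-- The family of virtual weight matrices of a prompt, for the data token with
zero-based index `i`. -/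
def WPfam {d T : ℕ} (u : Fin T → Fin d → ℝ) (w : Fin T → ℕ) (i : ℕ) :
    ℕ → Matrix (Fin d) (Fin d) ℝ :=
  fun ℓ => if ℓ = 1 then WPone u w (i == 0) else WPmat u w ℓ

/-- Output of the virtual network after `ℓ` layers:
`vnetOut … ℓ = W_ℓ act(W_{ℓ-1} act( ⋯ act(W_1 z) ⋯ ))`. -/
def vnetOut (d : ℕ) (act : ℝ → ℝ) (Ws : ℕ → Matrix (Fin d) (Fin d) ℝ)
    (z : Fin d → ℝ) : ℕ → Fin d → ℝ
  | 0 => z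
  | ℓ + 1 =>
      (Ws (ℓ + 1)).mulVec fun k =>
        if ℓ = 0 then vnetOut d act Ws z ℓ k else act (vnetOut d act Ws z ℓ k)

/-- The emulation property: for every admissible prompt and data tokens, the sequentially
generated tokens realize the virtual neural network encoded by the prompt
(with activation `act`). -/
def EmulatesWith (d : ℕ)
    (forward : List (Fin (4 * d + 8) → ℝ) → List (Fin (4 * d + 8) → ℝ))
    (act : ℝ → ℝ) : Prop :=
  ∀ B : ℝ, 1 ≤ B → ∀ T L : ℕ, 0 < T → 0 < L →
  ∀ U : Set (Fin d → ℝ), U ⊆ eball d B →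
  ∀ S : ℝ, max ((d : ℝ) * B ^ (4 * L) * (T : ℝ) ^ (2 * L)) (2 * (L : ℝ)) ≤ S →
  ∀ (u : Fin T → Fin d → ℝ) (w : Fin T → ℕ), ValidPrompt U T L u w →
  ∀ N : ℕ, 0 < N → ∀ z : Fin N → Fin d → ℝ, (∀ i k, z i k ∈ Set.Icc (0 : ℝ) 1) →
  ∀ (i : Fin N) (ℓ : ℕ), 1 ≤ ℓ → ℓ ≤ L →
    tokenAt forward (initialInput d T N u w S z) (T + N * ℓ + (i : ℕ) + 1)
      = promptToken d (vnetOut d act (WPfam u w (i : ℕ)) (z i) ℓ) (-(ℓ : ℤ))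
          (T + N * ℓ + (i : ℕ) + 1) S

/-- The embedding `x ↦ (xᵀ, 1, 0_{d-p-1}ᵀ)ᵀ ∈ ℝ^d` of an input `x ∈ ℝ^p`. -/
def embed (d p : ℕ) (x : Fin p → ℝ) : Fin d → ℝ :=
  fun k => if h : (k : ℕ) < p then x ⟨k, h⟩ else if (k : ℕ) = p then 1 else 0

/-- The function approximator `f̂_{Θ,H^P,L,p}`: first coordinate of the token at
position `T+1+L` generated from the prompt followed by the single data token. -/
def fhat {d : ℕ} (forward : List (Fin (4 * d + 8) → ℝ) → List (Fin (4 * d + 8) → ℝ))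
    {T : ℕ} (u : Fin T → Fin d → ℝ) (w : Fin T → ℕ) (S : ℝ) (L p : ℕ)
    (x : Fin p → ℝ) : ℝ :=
  tokenAt forward (initialInput d T 1 u w S fun _ => embed d p x) (T + 1 + L)
    ⟨0, by omega⟩

/-- The unit cube `[0,1]^p`. -/
def unitCube (p : ℕ) : Set (Fin p → ℝ) := Set.Icc 0 1

/-- The sup-distance `‖f - g‖_{L^∞([0,1]^p)}`. -/
def supDist (p : ℕ) (f g : (Fin p → ℝ) → ℝ) : ℝ :=
  ⨆ x : unitCube p, |f x.1 - g x.1|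

/-- Partial derivative (within the unit cube) in coordinate direction `i`. -/
def pderivW (p : ℕ) (i : Fin p) (f : (Fin p → ℝ) → ℝ) : (Fin p → ℝ) → ℝ :=
  fun x => fderivWithin ℝ f (unitCube p) x (Pi.single i 1)

/-- Iterated partial derivative along a list of coordinate directions. -/
def pderivList (p : ℕ) : List (Fin p) → ((Fin p → ℝ) → ℝ) → (Fin p → ℝ) → ℝ
  | [], f => f
  | i :: is, f => pderivList p is (pderivW p i f)

/-- The unit ball `C_u^β([0,1]^p)` of `β`-times continuously differentiable functions with
all partial derivatives of order `≤ β` bounded by `1` on the cube. -/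
def Hclass (p β : ℕ) : Set ((Fin p → ℝ) → ℝ) :=
  {f | ContDiffOn ℝ β f (unitCube p) ∧
    ∀ ls : List (Fin p), ls.length ≤ β →
      ∀ x ∈ unitCube p, |pderivList p ls f x| ≤ 1}

/-- `U_{d,r}` : the span of the first `r` standard basis vectors of `ℝ^d`. -/
def spanFirst (d r : ℕ) : Set (Fin d → ℝ) :=
  {v | ∀ k : Fin d, r ≤ (k : ℕ) → v k = 0}

/-- Hidden layers of a standard ReLU network of width `r` (with biases). -/
def nnHidden {p r : ℕ} (W0 : Matrix (Fin r) (Fin p) ℝ) (b0 : Fin r → ℝ)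
    (Wm : ℕ → Matrix (Fin r) (Fin r) ℝ) (bm : ℕ → Fin r → ℝ) (x : Fin p → ℝ) :
    ℕ → Fin r → ℝ
  | 0 => fun i => W0.mulVec x i + b0 i
  | k + 1 => fun i =>
      (Wm k).mulVec (fun j => relu (nnHidden W0 b0 Wm bm x k j)) i + bm k i

/-- The class `N(r,p,L)` of ReLU networks `ℝ^p → ℝ` of width `r` and depth `L`
(`L` affine maps with ReLU in between). -/
def NNclass (r p L : ℕ) : Set ((Fin p → ℝ) → ℝ) :=
  {f | if L = 1 then ∃ (a : Fin p → ℝ) (b : ℝ), f = fun x => (∑ i, a i * x i) + b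
    else ∃ (W0 : Matrix (Fin r) (Fin p) ℝ) (b0 : Fin r → ℝ)
      (Wm : ℕ → Matrix (Fin r) (Fin r) ℝ) (bm : ℕ → Fin r → ℝ)
      (wL : Fin r → ℝ) (bL : ℝ),
      f = fun x => (∑ j, wL j * relu (nnHidden W0 b0 Wm bm x (L - 2) j)) + bL}

/-- Operator norm (w.r.t. the Euclidean norm) of a `d × d` matrix. -/
def opNorm {d : ℕ} (W : Matrix (Fin d) (Fin d) ℝ) : ℝ :=
  ‖LinearMap.toContinuousLinearMap (Matrix.toEuclideanLin W)‖

/-- The class `W(r,d,U,B)` of coarse weight matrices. -/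
def coarseW (d r : ℕ) (U : Set (Fin d → ℝ)) (B : ℝ) :
    Set (Matrix (Fin d) (Fin d) ℝ) :=
  {W | (∃ ut uu : Fin r → Fin d → ℝ,
        (∀ k, ut k ∈ U) ∧ (∀ k, uu k ∈ U) ∧ W = ∑ k, vecMulVec (ut k) (uu k)) ∧
    opNorm W ≤ B ^ 2}

open Classical in
/-- Number of nonzero parameter entries of one transformer layer. -/
def layerNonzero {D : ℕ} (θ : TFLayer D) : ℕ :=
  (Finset.univ.filter fun p : Fin θ.M × Fin D × Fin D => θ.Q p.1 p.2.1 p.2.2 ≠ 0).card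
  + (Finset.univ.filter fun p : Fin θ.M × Fin D × Fin D => θ.K p.1 p.2.1 p.2.2 ≠ 0).card
  + (Finset.univ.filter fun p : Fin θ.M × Fin D × Fin D => θ.V p.1 p.2.1 p.2.2 ≠ 0).card
  + (Finset.univ.filter fun p : Fin θ.width × Fin D => θ.W1 p.1 p.2 ≠ 0).card
  + (Finset.univ.filter fun p : Fin D × Fin θ.width => θ.W2 p.1 p.2 ≠ 0).card

/-- Total number of nonzero parameter entries of a transformer. -/
def tfNonzero {D : ℕ} (Θ : List (TFLayer D)) : ℕ := (Θ.map layerNonzero).sum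

/-- All parameter entries of one layer bounded in absolute value by `c`. -/
def layerEntriesBounded {D : ℕ} (θ : TFLayer D) (c : ℝ) : Prop :=
  (∀ m i j, |θ.Q m i j| ≤ c) ∧ (∀ m i j, |θ.K m i j| ≤ c) ∧ (∀ m i j, |θ.V m i j| ≤ c)
  ∧ (∀ i j, |θ.W1 i j| ≤ c) ∧ ∀ i j, |θ.W2 i j| ≤ c

end PromptTF
end

open PromptTF Matrix

namespace PromptTF

theorem relu_of_nonneg {x : ℝ} (h : 0 ≤ x) : relu x = x := max_eq_left h

theorem relu_of_nonpos {x : ℝ} (h : x ≤ 0) : relu x = 0 := max_eq_right h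

theorem relu_sub_relu_neg (x : ℝ) : relu x - relu (-x) = x := by
  rcases le_total 0 x with h | h
  · rw [relu_of_nonneg h, relu_of_nonpos (by linarith)]; ring
  · rw [relu_of_nonpos h, relu_of_nonneg (by linarith)]; ring

section Framework

variable {X Y : Type}

/-- Linear span of a set of functions together with the constants. -/
def affSpan (S : Set (X → ℝ)) : Submodule ℝ (X → ℝ) := Submodule.span ℝ (insert 1 S)

/-- Activations of a list of pre-activations. -/
def reluSet (l : List (X → ℝ)) : Set (X → ℝ) := (fun ψ x => relu (ψ x)) '' {ψ | ψ ∈ l}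

/-- One hidden layer with at most `w` units whose pre-activations are affine in `S` and
whose activations span `T`. -/
def ReluStep (w : ℕ) (S T : Set (X → ℝ)) : Prop :=
  ∃ l : List (X → ℝ), l.length ≤ w ∧ (∀ ψ ∈ l, ψ ∈ affSpan S) ∧ T ⊆ affSpan (reluSet l)

/-- The functions `T` are affine outputs of `n` hidden ReLU layers of width at most `w` with
inputs affine in `S`. -/
def Computes (w : ℕ) : ℕ → Set (X → ℝ) → Set (X → ℝ) → Prop
  | 0, S, T => T ⊆ affSpan S
  | n + 1, S, T => ∃ U, ReluStep w S U ∧ Computes w n U T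

namespace affSpan

variable {S T : Set (X → ℝ)} {f g : X → ℝ}

theorem of_mem (h : f ∈ S) : f ∈ affSpan S := Submodule.subset_span (Set.mem_insert_of_mem _ h)

theorem congr (hg : g ∈ affSpan S) (h : ∀ x, f x = g x) : f ∈ affSpan S := (funext h : f = g) ▸ hg

theorem const (c : ℝ) : (fun _ => c) ∈ affSpan S := by
  have h : (1 : X → ℝ) ∈ affSpan S := Submodule.subset_span (Set.mem_insert _ _)
  have := (affSpan S).smul_mem c h
  convert this using 1
  ext x; simp

theorem add (hf : f ∈ affSpan S) (hg : g ∈ affSpan S) : (fun x => f x + g x) ∈ affSpan S :=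
  (affSpan S).add_mem hf hg

theorem sub (hf : f ∈ affSpan S) (hg : g ∈ affSpan S) : (fun x => f x - g x) ∈ affSpan S :=
  (affSpan S).sub_mem hf hg

theorem neg (hf : f ∈ affSpan S) : (fun x => -f x) ∈ affSpan S :=
  (affSpan S).neg_mem hf

theorem const_mul (c : ℝ) (hf : f ∈ affSpan S) : (fun x => c * f x) ∈ affSpan S :=
  (affSpan S).smul_mem c hf

theorem mul_const (c : ℝ) (hf : f ∈ affSpan S) : (fun x => f x * c) ∈ affSpan S := by
  simpa only [mul_comm c] using const_mul c hf

theorem div_const (c : ℝ) (hf : f ∈ affSpan S) : (fun x => f x / c) ∈ affSpan S := by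
  simpa only [div_eq_mul_inv] using mul_const c⁻¹ hf

theorem sum {ι : Type*} (s : Finset ι) {F : ι → X → ℝ} (h : ∀ i ∈ s, F i ∈ affSpan S) :
    (fun x => ∑ i ∈ s, F i x) ∈ affSpan S := by
  have := (affSpan S).sum_mem h
  convert this using 1
  ext x; simp

theorem le_of_subset (h : T ⊆ affSpan S) : affSpan T ≤ affSpan S := by
  refine Submodule.span_le.2 (Set.insert_subset ?_ h)
  exact Submodule.subset_span (Set.mem_insert _ _)

theorem mono (h : T ⊆ S) : affSpan T ≤ affSpan S := le_of_subset fun _ hf => of_mem (h hf)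

theorem relu_mem {l : List (X → ℝ)} (h : f ∈ l) : (fun x => relu (f x)) ∈ affSpan (reluSet l) :=
  of_mem ⟨f, h, rfl⟩

theorem relu_mem_of_nonneg {l : List (X → ℝ)} (h : f ∈ l) (hf : ∀ x, 0 ≤ f x) :
    f ∈ affSpan (reluSet l) := by
  convert relu_mem h using 1
  ext x; rw [relu_of_nonneg (hf x)]

theorem relu_mem_of_neg_mem {l : List (X → ℝ)} (h : f ∈ l) (h' : (fun x => -f x) ∈ l) :
    f ∈ affSpan (reluSet l) := by
  convert sub (relu_mem h) (relu_mem h') using 1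
  ext x; rw [relu_sub_relu_neg]

end affSpan

namespace ReluStep

variable {S S' T T' : Set (X → ℝ)} {w w' : ℕ}

theorem mono (h : ReluStep w S T) (hw : w ≤ w') (hS : S ⊆ affSpan S') (hT : T' ⊆ affSpan T) :
    ReluStep w' S' T' := by
  obtain ⟨l, hl, hl', hT0⟩ := h
  exact ⟨l, hl.trans hw, fun ψ hψ => affSpan.le_of_subset hS (hl' ψ hψ),
    fun f hf => affSpan.le_of_subset hT0 (hT hf)⟩

theorem union (h : ReluStep w S T) (h' : ReluStep w' S' T') :
    ReluStep (w + w') (S ∪ S') (T ∪ T') := by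
  obtain ⟨l, hl, hlS, hT⟩ := h
  obtain ⟨l', hl', hlS', hT'⟩ := h'
  refine ⟨l ++ l', by simp; omega, ?_, ?_⟩
  · intro ψ hψ
    rcases List.mem_append.1 hψ with h | h
    · exact affSpan.mono Set.subset_union_left (hlS ψ h)
    · exact affSpan.mono Set.subset_union_right (hlS' ψ h)
  · rintro f (hf | hf)
    · exact affSpan.mono (Set.image_mono fun ψ h => List.mem_append.2 (Or.inl h)) (hT hf)
    · exact affSpan.mono (Set.image_mono fun ψ h => List.mem_append.2 (Or.inr h)) (hT' hf)

theorem computes (h : ReluStep w S T) : Computes w 1 S T := ⟨T, h, fun _ hf => affSpan.of_mem hf⟩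

end ReluStep

namespace Computes

variable {S S' T T' U : Set (X → ℝ)} {w w' n m : ℕ}

theorem mono_right (h : Computes w n S T) (hT : T' ⊆ affSpan T) : Computes w n S T' := by
  induction n generalizing S with
  | zero => exact fun f hf => affSpan.le_of_subset h (hT hf)
  | succ n ih =>
    obtain ⟨U, h1, h2⟩ := h
    exact ⟨U, h1, ih h2⟩

theorem mono_left (h : Computes w n S T) (hS : S ⊆ affSpan S') : Computes w n S' T := by
  cases n with
  | zero => exact fun f hf => affSpan.le_of_subset hS (h hf)
  | succ n =>
    obtain ⟨U, h1, h2⟩ := h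
    exact ⟨U, h1.mono le_rfl hS fun f hf => affSpan.of_mem hf, h2⟩

theorem mono_width (h : Computes w n S T) (hw : w ≤ w') : Computes w' n S T := by
  induction n generalizing S with
  | zero => exact h
  | succ n ih =>
    obtain ⟨U, h1, h2⟩ := h
    exact ⟨U, h1.mono hw (fun f hf => affSpan.of_mem hf) fun f hf => affSpan.of_mem hf, ih h2⟩

theorem trans (h : Computes w n S T) (h' : Computes w m T U) : Computes w (n + m) S U := by
  induction n generalizing S with
  | zero => rw [Nat.zero_add]; exact h'.mono_left h
  | succ n ih =>
    obtain ⟨U', h1, h2⟩ := h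
    rw [Nat.add_right_comm]
    exact ⟨U', h1, ih h2⟩

theorem union (h : Computes w n S T) (h' : Computes w' n S' T') :
    Computes (w + w') n (S ∪ S') (T ∪ T') := by
  induction n generalizing S S' with
  | zero =>
    rintro f (hf | hf)
    · exact affSpan.mono Set.subset_union_left (h hf)
    · exact affSpan.mono Set.subset_union_right (h' hf)
  | succ n ih =>
    obtain ⟨U, h1, h2⟩ := h
    obtain ⟨U', h1', h2'⟩ := h'
    exact ⟨U ∪ U', h1.union h1', ih h2 h2'⟩

theorem empty : Computes 0 n S (∅ : Set (X → ℝ)) := by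
  induction n generalizing S with
  | zero => exact Set.empty_subset _
  | succ n ih => exact ⟨∅, ⟨[], by simp, by simp, Set.empty_subset _⟩, ih⟩

theorem biUnion {ι : Type*} (s : Finset ι) {T : ι → Set (X → ℝ)}
    (h : ∀ i ∈ s, Computes w n S (T i)) : Computes (s.card * w) n S (⋃ i ∈ s, T i) := by
  classical
  induction s using Finset.induction_on with
  | empty => simpa using empty
  | insert a s ha ih =>
    have h1 := (h a (Finset.mem_insert_self a s)).union
      (ih fun i hi => h i (Finset.mem_insert_of_mem hi))
    rw [Finset.card_insert_of_notMem ha, Finset.set_biUnion_insert, Nat.succ_mul, Nat.add_comm]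
    rwa [Set.union_self] at h1

theorem iUnion {ι : Type*} [Fintype ι] {T : ι → Set (X → ℝ)}
    (h : ∀ i, Computes w n S (T i)) : Computes (Fintype.card ι * w) n S (⋃ i, T i) := by
  simpa using biUnion Finset.univ fun i _ => h i

theorem refl_of_nonneg (l : List (X → ℝ)) (h : ∀ f ∈ l, ∀ x, 0 ≤ f x) :
    Computes l.length n {f | f ∈ l} {f | f ∈ l} := by
  induction n with
  | zero => exact fun f hf => affSpan.of_mem hf
  | succ n ih =>
    exact ⟨_, ⟨l, le_rfl, fun ψ hψ => affSpan.of_mem hψ,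
      fun f hf => affSpan.relu_mem_of_nonneg hf (h f hf)⟩, ih⟩

/-- Nonnegative functions are carried along by one unit each. -/
theorem carry (h : Computes w n S T) (l : List (X → ℝ)) (hl : ∀ f ∈ l, ∀ x, 0 ≤ f x) :
    Computes (w + l.length) n (S ∪ {f | f ∈ l}) (T ∪ {f | f ∈ l}) :=
  h.union (refl_of_nonneg l hl)

/-- A single function is carried along by two units. -/
theorem refl_singleton (f : X → ℝ) : Computes 2 n {f} {f} := by
  induction n with
  | zero => exact fun f hf => affSpan.of_mem hf
  | succ n ih =>
    refine ⟨_, ⟨[f, fun x => -f x], le_rfl, ?_, ?_⟩, ih⟩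
    · simp only [List.mem_cons, List.not_mem_nil, or_false, forall_eq_or_imp, forall_eq]
      exact ⟨affSpan.of_mem rfl, affSpan.neg (affSpan.of_mem rfl)⟩
    · rintro g rfl
      exact affSpan.relu_mem_of_neg_mem (by simp) (by simp)

theorem pad_singleton {f : X → ℝ} (h : Computes w n S {f}) (hw : 2 ≤ w) (hn : n ≤ m) :
    Computes w m S {f} := by
  obtain ⟨k, rfl⟩ := Nat.exists_eq_add_of_le hn
  exact h.trans ((refl_singleton f).mono_width hw)

/-- Composition with a map of the underlying domains. -/
theorem comp (π : Y → X) (h : Computes w n S T) :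
    Computes w n ((fun f : X → ℝ => f ∘ π) '' S) ((fun f : X → ℝ => f ∘ π) '' T) := by
  have key : ∀ {S : Set (X → ℝ)} {f : X → ℝ}, f ∈ affSpan S →
      f ∘ π ∈ affSpan ((fun f : X → ℝ => f ∘ π) '' S) := by
    intro S f hf
    induction hf using Submodule.span_induction with
    | mem g hg =>
      rcases hg with rfl | hg
      · exact affSpan.const 1
      · exact affSpan.of_mem ⟨g, hg, rfl⟩
    | zero => exact Submodule.zero_mem _
    | add f g _ _ h1 h2 => exact affSpan.add h1 h2
    | smul c f _ h1 => exact affSpan.const_mul c h1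
  induction n generalizing S with
  | zero =>
    rintro _ ⟨f, hf, rfl⟩
    exact key (h hf)
  | succ n ih =>
    obtain ⟨U, ⟨l, hl, hlS, hU⟩, h2⟩ := h
    refine ⟨_, ⟨l.map fun f => f ∘ π, by simpa using hl, ?_, ?_⟩, ih h2⟩
    · intro ψ hψ
      obtain ⟨f, hf, rfl⟩ := List.mem_map.1 hψ
      exact key (hlS f hf)
    · rintro _ ⟨f, hf, rfl⟩
      refine affSpan.mono ?_ (key (hU hf))
      rintro _ ⟨_, ⟨ψ, hψ, rfl⟩, rfl⟩
      exact ⟨ψ ∘ π, List.mem_map.2 ⟨ψ, hψ, rfl⟩, rfl⟩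

/-- A computation on `Y` with inputs pulled back from `X` extends to `X`. -/
theorem extend (π : Y → X) {T : Set (Y → ℝ)}
    (h : Computes w n ((fun f : X → ℝ => f ∘ π) '' S) T) :
    ∃ T' : Set (X → ℝ), Computes w n S T' ∧ ∀ f ∈ T, ∃ g ∈ T', g ∘ π = f := by
  have key : ∀ {S : Set (X → ℝ)} {f : Y → ℝ}, f ∈ affSpan ((fun f : X → ℝ => f ∘ π) '' S) →
      ∃ g ∈ affSpan S, g ∘ π = f := by
    intro S f hf
    induction hf using Submodule.span_induction with
    | mem g hg =>
      rcases hg with rfl | ⟨g, hg, rfl⟩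
      · exact ⟨_, affSpan.const 1, rfl⟩
      · exact ⟨g, affSpan.of_mem hg, rfl⟩
    | zero => exact ⟨0, Submodule.zero_mem _, rfl⟩
    | add f g _ _ h1 h2 =>
      obtain ⟨f', hf', rfl⟩ := h1
      obtain ⟨g', hg', rfl⟩ := h2
      exact ⟨_, affSpan.add hf' hg', rfl⟩
    | smul c f _ h1 =>
      obtain ⟨f', hf', rfl⟩ := h1
      exact ⟨_, affSpan.const_mul c hf', rfl⟩
  induction n generalizing S with
  | zero => exact ⟨affSpan S, le_rfl, fun f hf => key (h hf)⟩
  | succ n ih =>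
    obtain ⟨U, ⟨l, hl, hlS, hU⟩, h2⟩ := h
    choose! g hg using fun ψ hψ => key (hlS ψ hψ)
    have hU' : reluSet l = (fun f : X → ℝ => f ∘ π) '' reluSet (l.map g) := by
      ext f
      simp only [reluSet, Set.mem_image, Set.mem_ofPred_eq, List.mem_map]
      constructor
      · rintro ⟨ψ, hψ, rfl⟩
        refine ⟨_, ⟨g ψ, ⟨ψ, hψ, rfl⟩, rfl⟩, ?_⟩
        ext y
        simp only [Function.comp_apply]
        rw [← (hg ψ hψ).2]; simp [(hg ψ hψ).2]
      · rintro ⟨_, ⟨_, ⟨ψ, hψ, rfl⟩, rfl⟩, rfl⟩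
        refine ⟨ψ, hψ, ?_⟩
        ext y
        simp only [Function.comp_apply]
        exact congrArg relu (congrFun (hg ψ hψ).2 y).symm
    obtain ⟨T', hT', hT''⟩ := ih (S := reluSet (l.map g)) (hU' ▸ h2.mono_left hU)
    refine ⟨T', ⟨_, ⟨l.map g, by simpa using hl, ?_, fun f hf => affSpan.of_mem hf⟩, hT'⟩, hT''⟩
    intro ψ hψ
    obtain ⟨f, hf, rfl⟩ := List.mem_map.1 hψ
    exact (hg f hf).1

end Computes

end Framework

section Gadgets

variable {X : Type}

theorem ramp_eq {d c : ℕ} {f η : ℝ} (hη : 0 < η) (hf0 : 0 ≤ f) (hf1 : f ≤ 1 - η) :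
    relu (((d : ℝ) + f - c + η) / η) - relu (((d : ℝ) + f - c) / η) = if c ≤ d then 1 else 0 := by
  split_ifs with h
  · have : (c : ℝ) ≤ d := by exact_mod_cast h
    rw [relu_of_nonneg (div_nonneg (by linarith) hη.le),
      relu_of_nonneg (div_nonneg (by linarith) hη.le)]
    field_simp
    ring
  · have : (d : ℝ) + 1 ≤ c := by exact_mod_cast Nat.lt_of_not_le h
    rw [relu_of_nonpos (div_nonpos_of_nonpos_of_nonneg (by linarith) hη.le),
      relu_of_nonpos (div_nonpos_of_nonpos_of_nonneg (by linarith) hη.le), sub_zero]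

theorem sum_range_ite_succ_le (n q : ℕ) (h : q ≤ n) :
    ∑ j ∈ Finset.range n, (if j + 1 ≤ q then (1 : ℝ) else 0) = q := by
  rw [Finset.sum_boole]
  congr 1
  rw [show (Finset.range n).filter (fun j => j + 1 ≤ q) = Finset.range q by
    ext j; simp; omega]
  simp

theorem sum_range_ite_digit (b c d : ℕ) (hb : 1 ≤ b) (hc : 0 < c) (hd : d < b * c) :
    ∑ j ∈ Finset.range (b - 1), (if (j + 1) * c ≤ d then (1 : ℝ) else 0) = (d / c : ℕ) := by
  have h1 : d / c ≤ b - 1 := by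
    have := (Nat.div_lt_iff_lt_mul hc).2 hd
    omega
  rw [← sum_range_ite_succ_le _ _ h1]
  refine Finset.sum_congr rfl fun j _ => ?_
  simp only [Nat.le_div_iff_mul_le hc]

/-- The leading base-`b` digit is obtained in one layer. -/
theorem reluStep_digit {b c : ℕ} (hb : 1 ≤ b) (hc : 0 < c) {d : X → ℕ} {f a : X → ℝ} {η : ℝ}
    (hη : 0 < η) (hf0 : ∀ x, 0 ≤ f x) (hf1 : ∀ x, f x ≤ 1 - η) (ha : ∀ x, 0 ≤ a x)
    (hd : ∀ x, d x < b * c) :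
    ReluStep (2 * b) {fun x => (d x : ℝ) + f x, a}
      {fun x => ((d x % c : ℕ) : ℝ) + f x, fun x => a x + c * (d x / c : ℕ)} := by
  set y : X → ℝ := fun x => (d x : ℝ) + f x with hy
  set r1 : ℕ → X → ℝ := fun j x => (y x - ((j + 1) * c : ℕ) + η) / η with hr1
  set r2 : ℕ → X → ℝ := fun j x => (y x - ((j + 1) * c : ℕ)) / η with hr2
  set l : List (X → ℝ) := [y, a] ++ ((List.range (b - 1)).map r1 ++ (List.range (b - 1)).map r2)
    with hl
  have hyS : y ∈ affSpan {y, a} := affSpan.of_mem (by simp)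
  have hyl : y ∈ affSpan (reluSet l) := affSpan.relu_mem_of_nonneg (by simp [hl]) fun x =>
    add_nonneg (Nat.cast_nonneg _) (hf0 x)
  have hal : a ∈ affSpan (reluSet l) := affSpan.relu_mem_of_nonneg (by simp [hl]) ha
  have hq : (fun x => ((d x / c : ℕ) : ℝ)) ∈ affSpan (reluSet l) := by
    have : (fun x => ∑ j ∈ Finset.range (b - 1), (relu (r1 j x) - relu (r2 j x)))
        ∈ affSpan (reluSet l) := by
      refine affSpan.sum _ fun j hj => affSpan.sub ?_ ?_
      · exact affSpan.relu_mem (by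
          simp only [hl, List.mem_append, List.mem_map, List.mem_range]
          exact Or.inr (Or.inl ⟨j, Finset.mem_range.1 hj, rfl⟩))
      · exact affSpan.relu_mem (by
          simp only [hl, List.mem_append, List.mem_map, List.mem_range]
          exact Or.inr (Or.inr ⟨j, Finset.mem_range.1 hj, rfl⟩))
    convert this using 1
    ext x
    rw [← sum_range_ite_digit b c (d x) hb hc (hd x)]
    refine Finset.sum_congr rfl fun j _ => ?_
    exact (ramp_eq hη (hf0 x) (hf1 x)).symm
  refine ⟨l, by simp [hl]; omega, ?_, ?_⟩
  · intro ψ hψ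
    simp only [hl, List.mem_append, List.mem_map, List.mem_range, List.mem_cons, List.not_mem_nil,
      or_false] at hψ
    rcases hψ with (rfl | rfl) | ⟨j, -, rfl⟩ | ⟨j, -, rfl⟩
    · exact hyS
    · exact affSpan.of_mem (by simp)
    · exact affSpan.div_const _ (affSpan.add (affSpan.sub hyS (affSpan.const _)) (affSpan.const _))
    · exact affSpan.div_const _ (affSpan.sub hyS (affSpan.const _))
  · rintro g (rfl | rfl)
    · refine affSpan.congr (affSpan.sub hyl (affSpan.const_mul (c : ℝ) hq)) fun x => ?_
      have : (d x : ℝ) = c * (d x / c : ℕ) + (d x % c : ℕ) := by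
        exact_mod_cast (Nat.div_add_mod (d x) c).symm
      simp only [hy]
      linarith
    · exact affSpan.add hal (affSpan.const_mul _ hq)

/-- The integer and fractional part of a function bounded by `b ^ s` are obtained in `s` layers. -/
theorem computes_floor {b : ℕ} (hb : 1 ≤ b) (s : ℕ) {d : X → ℕ} {f a : X → ℝ} {η : ℝ}
    (hη : 0 < η) (hf0 : ∀ x, 0 ≤ f x) (hf1 : ∀ x, f x ≤ 1 - η) (ha : ∀ x, 0 ≤ a x)
    (hd : ∀ x, d x < b ^ s) :
    Computes (2 * b) s {fun x => (d x : ℝ) + f x, a} {f, fun x => a x + d x} := by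
  induction s generalizing d a with
  | zero =>
    have h0 : ∀ x, d x = 0 := fun x => by simpa using hd x
    simp only [h0, Nat.cast_zero, zero_add, add_zero]
    exact fun f hf => affSpan.of_mem hf
  | succ s ih =>
    have hc : 0 < b ^ s := by positivity
    refine ⟨_, reluStep_digit hb hc hη hf0 hf1 ha (fun x => by rw [← pow_succ']; exact hd x), ?_⟩
    have := ih (d := fun x => d x % b ^ s) (a := fun x => a x + (b ^ s : ℕ) * (d x / b ^ s : ℕ))
      (fun x => add_nonneg (ha x) (by positivity)) (fun x => Nat.mod_lt _ hc)
    convert this using 3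
    ext x
    have : (d x : ℝ) = (b ^ s : ℕ) * (d x / b ^ s : ℕ) + (d x % b ^ s : ℕ) := by
      exact_mod_cast (Nat.div_add_mod (d x) (b ^ s)).symm
    linarith

/-- Division with remainder in `s` layers. -/
theorem computes_divMod {b : ℕ} (hb : 1 ≤ b) (s : ℕ) {c : ℕ} {d r : X → ℕ}
    (hr : ∀ x, r x < c) (hd : ∀ x, d x < b ^ s) :
    Computes (2 * b) s {fun x => ((d x * c + r x : ℕ) : ℝ)}
      {fun x => (d x : ℝ), fun x => (r x : ℝ)} := by
  rcases Nat.eq_zero_or_pos c with rfl | hc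
  · have : IsEmpty X := ⟨fun x => absurd (hr x) (Nat.not_lt_zero _)⟩
    refine (Computes.refl_singleton (n := s) (0 : X → ℝ)).mono_width (w' := 2 * b) (by omega)
      |>.mono_left ?_ |>.mono_right ?_
    · intro f _; exact affSpan.of_mem (Subsingleton.elim _ _)
    · intro f _; exact affSpan.of_mem (Subsingleton.elim _ _)
  have hc' : (0 : ℝ) < c := by exact_mod_cast hc
  have h := computes_floor (X := X) hb s (d := d) (f := fun x => (r x : ℝ) / c)
    (a := fun _ => 0) (η := 1 / c) (by positivity) (fun x => by positivity)
    (fun x => by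
      have : (r x : ℝ) + 1 ≤ c := by exact_mod_cast hr x
      rw [le_sub_iff_add_le, ← add_div, div_le_one hc']
      exact this) (fun _ => le_rfl) hd
  refine (h.mono_left ?_).mono_right ?_
  · rintro g (rfl | rfl)
    · have : (fun x => (((d x * c + r x : ℕ) : ℝ)) / c) ∈
          affSpan {fun x : X => ((d x * c + r x : ℕ) : ℝ)} :=
        affSpan.div_const _ (affSpan.of_mem rfl)
      refine affSpan.congr this fun x => ?_
      push_cast; field_simp
    · exact affSpan.const 0
  · rintro g (rfl | rfl)
    · have : (fun x => (0 : ℝ) + d x) ∈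
        affSpan {fun x => (r x : ℝ) / c, fun x : X => (0 : ℝ) + d x} := affSpan.of_mem (by simp)
      simpa using this
    · have : (fun x => (r x : ℝ) / c * c) ∈
        affSpan {fun x => (r x : ℝ) / c, fun x : X => (0 : ℝ) + d x} :=
        affSpan.mul_const _ (affSpan.of_mem (by simp))
      refine affSpan.congr this fun x => ?_
      field_simp

/-- Selecting the value with a prescribed index, in one layer. -/
theorem select_eq (B k p v : ℕ) (hv : v < B) :
    relu ((v : ℝ) + B * ((k : ℝ) - p)) - B * relu ((v : ℝ) + B * ((k : ℝ) - p) - (B - 1))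
      + (B - 1) * relu ((v : ℝ) + B * ((k : ℝ) - p) - B) = if k = p then (v : ℝ) else 0 := by
  have hvB : (v : ℝ) + 1 ≤ B := by exact_mod_cast hv
  have hv0 : (0 : ℝ) ≤ v := Nat.cast_nonneg _
  have hB : (0 : ℝ) ≤ B := Nat.cast_nonneg _
  rcases lt_trichotomy k p with h | rfl | h
  · have h1 : (k : ℝ) + 1 ≤ p := by exact_mod_cast h
    have h2 : (B : ℝ) * (k - p) ≤ -B := by nlinarith
    rw [relu_of_nonpos (by linarith), relu_of_nonpos (by linarith), relu_of_nonpos (by linarith),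
      if_neg h.ne]
    ring
  · rw [sub_self, mul_zero, add_zero, relu_of_nonneg hv0, relu_of_nonpos (by linarith),
      relu_of_nonpos (by linarith), if_pos rfl]
    ring
  · have h1 : (p : ℝ) + 1 ≤ k := by exact_mod_cast h
    have h2 : (B : ℝ) ≤ B * (k - p) := by nlinarith
    rw [relu_of_nonneg (by linarith), relu_of_nonneg (by linarith), relu_of_nonneg (by linarith),
      if_neg h.ne']
    ring

/-- Reading off the digit with index `k` of a base-`b ^ n` number with `m` digits. -/
theorem computes_readDigit {b : ℕ} (hb : 1 ≤ b) (n : ℕ) (m : ℕ) (v : ℕ → X → ℕ)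
    (hv : ∀ i x, v i x < b ^ n) (k : X → ℕ) (a : X → ℝ) (ha : ∀ x, 0 ≤ a x) :
    Computes (2 * b + 4) (m * (n + 1))
      {fun x => ((∑ i ∈ Finset.range m, v i x * (b ^ n) ^ i : ℕ) : ℝ), fun x => (k x : ℝ), a}
      {fun x => a x + ∑ i ∈ Finset.range m, if k x = i then (v i x : ℝ) else 0} := by
  have hB : 0 < b ^ n := by positivity
  have hY : ∀ m x, ∑ i ∈ Finset.range m, v i x * (b ^ n) ^ i < (b ^ n) ^ m := by
    intro m x
    induction m with
    | zero => simp
    | succ m ih =>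
      rw [Finset.sum_range_succ, pow_succ]
      have := Nat.mul_le_mul_right ((b ^ n) ^ m) (Nat.succ_le_of_lt (hv m x))
      rw [Nat.succ_mul] at this
      linarith
  induction m generalizing a with
  | zero =>
    rw [Nat.zero_mul]
    rintro f rfl
    simp only [Finset.range_zero, Finset.sum_empty, add_zero]
    exact affSpan.of_mem (by simp)
  | succ m ih =>
    set R : X → ℝ := fun x => ((∑ i ∈ Finset.range m, v i x * (b ^ n) ^ i : ℕ) : ℝ) with hR
    set V : X → ℝ := fun x => (v m x : ℝ) with hV
    set κ : X → ℝ := fun x => (k x : ℝ) with hκ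
    have h1 : Computes (2 * b + 4) n
        {fun x => ((∑ i ∈ Finset.range (m + 1), v i x * (b ^ n) ^ i : ℕ) : ℝ), κ, a}
        {V, R, κ, a} := by
      have h := (computes_divMod (X := X) hb n (c := (b ^ n) ^ m) (hY m) (hv m)).carry [κ, a]
        (by simp only [List.mem_cons, List.not_mem_nil, or_false, forall_eq_or_imp, forall_eq]
            exact ⟨fun x => Nat.cast_nonneg _, ha⟩)
      refine ((h.mono_width (by simp)).mono_left ?_).mono_right ?_
      · rintro g (rfl | hg)
        · refine affSpan.of_mem (Or.inl ?_)
          ext x; rw [Finset.sum_range_succ, Nat.add_comm]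
        · simp only [List.mem_cons, List.not_mem_nil, or_false] at hg
          exact affSpan.of_mem (Or.inr hg)
      · intro g hg
        refine affSpan.of_mem ?_
        simp only [List.mem_cons, List.not_mem_nil, or_false]
        rcases hg with rfl | rfl | rfl | rfl
        · exact Or.inl (Or.inl rfl)
        · exact Or.inl (Or.inr rfl)
        · exact Or.inr (Or.inl rfl)
        · exact Or.inr (Or.inr rfl)
    set a' : X → ℝ := fun x => a x + if k x = m then (v m x : ℝ) else 0 with ha'
    have h2 : ReluStep (2 * b + 4) {V, R, κ, a} {R, κ, a'} := by
      set t : X → ℝ := fun x => V x + ((b ^ n : ℕ) : ℝ) * (κ x - (m : ℝ)) with ht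
      set l : List (X → ℝ) := [t, fun x => t x - (((b ^ n : ℕ) : ℝ) - 1),
        fun x => t x - ((b ^ n : ℕ) : ℝ), R, κ, a] with hl
      have htS : t ∈ affSpan {V, R, κ, a} :=
        affSpan.add (affSpan.of_mem (by simp)) (affSpan.const_mul _
          (affSpan.sub (affSpan.of_mem (by simp)) (affSpan.const _)))
      refine ⟨l, by simp [hl]; omega, ?_, ?_⟩
      · intro ψ hψ
        simp only [hl, List.mem_cons, List.not_mem_nil, or_false] at hψ
        rcases hψ with rfl | rfl | rfl | rfl | rfl | rfl
        · exact htS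
        · exact affSpan.sub htS (affSpan.const _)
        · exact affSpan.sub htS (affSpan.const _)
        all_goals exact affSpan.of_mem (by simp)
      · rintro g (rfl | rfl | rfl)
        · exact affSpan.relu_mem_of_nonneg (by simp [hl]) fun x => Nat.cast_nonneg _
        · exact affSpan.relu_mem_of_nonneg (by simp [hl]) fun x => Nat.cast_nonneg _
        · have e1 : t ∈ l := by simp [hl]
          have e2 : (fun x => t x - (((b ^ n : ℕ) : ℝ) - 1)) ∈ l := by simp [hl]
          have e3 : (fun x => t x - ((b ^ n : ℕ) : ℝ)) ∈ l := by simp [hl]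
          have e4 : a ∈ l := by simp [hl]
          have := affSpan.add (affSpan.relu_mem_of_nonneg e4 ha)
            (affSpan.add (affSpan.sub (affSpan.relu_mem e1)
              (affSpan.const_mul ((b ^ n : ℕ) : ℝ) (affSpan.relu_mem e2)))
              (affSpan.const_mul (((b ^ n : ℕ) : ℝ) - 1) (affSpan.relu_mem e3)))
          refine affSpan.congr this fun x => ?_
          simp only [ha', ht, hV, hκ]
          rw [select_eq _ _ _ _ (hv m x)]
    have h3 := (h1.trans h2.computes).trans (ih a' fun x => by
      simp only [ha']; split_ifs <;> [exact add_nonneg (ha x) (Nat.cast_nonneg _);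
        simpa using ha x])
    rw [show n + 1 + m * (n + 1) = (m + 1) * (n + 1) by ring] at h3
    convert h3 using 2
    ext x
    rw [Finset.sum_range_succ, ha']
    ring

end Gadgets

section Lookup

variable {X : Type}

theorem exists_interpolation (f : ℕ → ℝ) (n : ℕ) :
    ∃ c : ℕ → ℝ, ∀ k ≤ n, f k = f 0 + ∑ t ∈ Finset.range n, c t * relu ((k : ℝ) - t) := by
  induction n with
  | zero => exact ⟨0, fun k hk => by simp [Nat.le_zero.1 hk]⟩
  | succ n ih =>
    obtain ⟨c, hc⟩ := ih
    set e := f (n + 1) - (f 0 + ∑ t ∈ Finset.range n, c t * relu (((n + 1 : ℕ) : ℝ) - t)) with he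
    refine ⟨fun t => if t = n then e else c t, fun k hk => ?_⟩
    have hsum : ∑ t ∈ Finset.range n, (if t = n then e else c t) * relu ((k : ℝ) - t)
        = ∑ t ∈ Finset.range n, c t * relu ((k : ℝ) - t) :=
      Finset.sum_congr rfl fun t ht => by rw [if_neg (Finset.mem_range.1 ht).ne]
    rw [Finset.sum_range_succ]
    beta_reduce
    rw [hsum, if_pos rfl]
    rcases Nat.lt_or_ge n k with h | h
    · obtain rfl : k = n + 1 := by omega
      have : relu (((n + 1 : ℕ) : ℝ) - n) = 1 := by
        rw [relu_of_nonneg] <;> push_cast <;> linarith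
      rw [this, he]; ring
    · have : relu ((k : ℝ) - n) = 0 := relu_of_nonpos (by
        have : (k : ℝ) ≤ n := by exact_mod_cast h
        linarith)
      rw [this, hc k h]; ring

theorem abs_eq_relu (x : ℝ) : |x| = 2 * relu x - x := by
  rcases le_total 0 x with h | h
  · rw [relu_of_nonneg h, abs_of_nonneg h]; ring
  · rw [relu_of_nonpos h, abs_of_nonpos h]; ring

theorem relu_bump {j j' g γ : ℕ} {ρ : ℝ} (h0 : 0 ≤ ρ) (h1 : ρ ≤ 1) :
    relu (ρ - |(j : ℝ) - j'| - |(g : ℝ) - γ|) = if g = γ then if j = j' then ρ else 0 else 0 := by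
  have hint : ∀ a b : ℕ, a ≠ b → (1 : ℝ) ≤ |(a : ℝ) - b| := by
    intro a b hab
    have : (1 : ℤ) ≤ |(a : ℤ) - b| := Int.one_le_abs (by omega)
    exact_mod_cast this
  split_ifs with hg hj
  · subst hg; subst hj
    simp [relu_of_nonneg h0]
  · have := hint j j' hj
    exact relu_of_nonpos (by have := abs_nonneg ((g : ℝ) - γ); linarith)
  · have := hint g γ hg
    exact relu_of_nonpos (by have := abs_nonneg ((j : ℝ) - j'); linarith)

/-- One slice of a table of real numbers with `N ^ 2` entries is read in two layers. -/
theorem computes_slice {N : ℕ} (ρ : ℕ → ℕ → ℝ) (hρ0 : ∀ i j, 0 ≤ ρ i j)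
    (hρ1 : ∀ i j, ρ i j ≤ 1) (γ : ℕ) (i j g : X → ℕ) (hi : ∀ x, i x < N) (hj : ∀ x, j x < N)
    (a : X → ℝ) (ha : ∀ x, 0 ≤ a x) :
    Computes (2 * N + 5) 2
      {fun x => (i x : ℝ), fun x => (j x : ℝ), fun x => (g x : ℝ), a}
      {fun x => (i x : ℝ), fun x => (j x : ℝ), fun x => (g x : ℝ),
        fun x => a x + if g x = γ then ρ (i x) (j x) else 0} := by
  set I : X → ℝ := fun x => (i x : ℝ) with hI
  set J : X → ℝ := fun x => (j x : ℝ) with hJ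
  set G : X → ℝ := fun x => (g x : ℝ) with hG
  have hI0 : ∀ x, 0 ≤ I x := fun x => Nat.cast_nonneg _
  have hJ0 : ∀ x, 0 ≤ J x := fun x => Nat.cast_nonneg _
  have hG0 : ∀ x, 0 ≤ G x := fun x => Nat.cast_nonneg _
  set l : List (X → ℝ) := [I, J, G, a, fun x => G x - (γ : ℝ)] ++
    ((List.range N).map (fun (t : ℕ) x => I x - (t : ℝ)) ++
      (List.range N).map (fun (t : ℕ) x => J x - (t : ℝ))) with hl
  have mI : I ∈ affSpan (reluSet l) := affSpan.relu_mem_of_nonneg (by simp [hl]) hI0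
  have mJ : J ∈ affSpan (reluSet l) := affSpan.relu_mem_of_nonneg (by simp [hl]) hJ0
  have mG : G ∈ affSpan (reluSet l) := affSpan.relu_mem_of_nonneg (by simp [hl]) hG0
  have ma : a ∈ affSpan (reluSet l) := affSpan.relu_mem_of_nonneg (by simp [hl]) ha
  have mGγ : (fun x => |G x - (γ : ℝ)|) ∈ affSpan (reluSet l) := by
    have h : (fun x => G x - (γ : ℝ)) ∈ l := by simp [hl]
    refine affSpan.congr (affSpan.sub (affSpan.const_mul 2 (affSpan.relu_mem h))
      (affSpan.sub mG (affSpan.const (γ : ℝ)))) fun x => abs_eq_relu _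
  have mJt : ∀ t < N, (fun x => |J x - (t : ℝ)|) ∈ affSpan (reluSet l) := by
    intro t ht
    have h : (fun x => J x - (t : ℝ)) ∈ l := by
      simp only [hl, List.mem_append, List.mem_map, List.mem_range]
      exact Or.inr (Or.inr ⟨t, ht, rfl⟩)
    refine affSpan.congr (affSpan.sub (affSpan.const_mul 2 (affSpan.relu_mem h))
      (affSpan.sub mJ (affSpan.const (t : ℝ)))) fun x => abs_eq_relu _
  have mρ : ∀ t, (fun x => ρ (i x) t) ∈ affSpan (reluSet l) := by
    intro t
    obtain ⟨c, hc⟩ := exists_interpolation (fun k => ρ k t) N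
    refine affSpan.congr (affSpan.add (affSpan.const (ρ 0 t))
      (affSpan.sum (Finset.range N) (F := fun s x => c s * relu (I x - (s : ℝ)))
        fun s hs => affSpan.const_mul _ (affSpan.relu_mem ?_))) fun x => hc (i x) (hi x).le
    simp only [hl, List.mem_append, List.mem_map, List.mem_range]
    exact Or.inr (Or.inl ⟨s, Finset.mem_range.1 hs, rfl⟩)
  set ψ : ℕ → X → ℝ := fun t x => ρ (i x) t - |J x - (t : ℝ)| - |G x - (γ : ℝ)| with hψ
  set l' : List (X → ℝ) := [I, J, G, a] ++ (List.range N).map ψ with hl'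
  have hA : ReluStep (2 * N + 5) {I, J, G, a} (affSpan (reluSet l)) := by
    refine ⟨l, by simp [hl]; omega, ?_, le_rfl⟩
    intro f hf
    simp only [hl, List.mem_append, List.mem_map, List.mem_range, List.mem_cons,
      List.not_mem_nil, or_false] at hf
    rcases hf with (rfl | rfl | rfl | rfl | rfl) | ⟨t, -, rfl⟩ | ⟨t, -, rfl⟩
    iterate 4 exact affSpan.of_mem (by simp)
    all_goals exact affSpan.sub (affSpan.of_mem (by simp)) (affSpan.const _)
  have hB : ReluStep (2 * N + 5) (affSpan (reluSet l) : Set (X → ℝ))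
      {I, J, G, fun x => a x + if g x = γ then ρ (i x) (j x) else 0} := by
    refine ⟨l', by simp [hl']; omega, ?_, ?_⟩
    · intro f hf
      refine affSpan.of_mem ?_
      simp only [hl', List.mem_append, List.mem_map, List.mem_range, List.mem_cons,
        List.not_mem_nil, or_false] at hf
      rcases hf with (rfl | rfl | rfl | rfl) | ⟨t, ht, rfl⟩
      · exact mI
      · exact mJ
      · exact mG
      · exact ma
      · exact affSpan.sub (affSpan.sub (mρ t) (mJt t ht)) mGγ
    · rintro f (rfl | rfl | rfl | rfl)
      · exact affSpan.relu_mem_of_nonneg (by simp [hl']) hI0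
      · exact affSpan.relu_mem_of_nonneg (by simp [hl']) hJ0
      · exact affSpan.relu_mem_of_nonneg (by simp [hl']) hG0
      · refine affSpan.congr (affSpan.add (affSpan.relu_mem_of_nonneg (f := a) (l := l')
          (by simp [hl']) ha) (affSpan.sum (Finset.range N) (F := fun t x => relu (ψ t x))
            fun t ht => affSpan.relu_mem ?_)) fun x => ?_
        · simp only [hl', List.mem_append, List.mem_map, List.mem_range]
          exact Or.inr ⟨t, Finset.mem_range.1 ht, rfl⟩
        · congr 1
          simp only [hψ, hJ, hG, relu_bump (hρ0 _ _) (hρ1 _ _)]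
          split_ifs with h
          · rw [Finset.sum_ite_eq, if_pos (Finset.mem_range.2 (hj x))]
          · simp
  exact ⟨_, hA, _, hB, fun f hf => affSpan.of_mem hf⟩

/-- A table of real numbers with `m * N ^ 2` entries is read in `2 * m` layers. -/
theorem computes_lookup {N : ℕ} (ρ : ℕ → ℕ → ℕ → ℝ) (hρ0 : ∀ γ i j, 0 ≤ ρ γ i j)
    (hρ1 : ∀ γ i j, ρ γ i j ≤ 1) (i j g : X → ℕ) (hi : ∀ x, i x < N) (hj : ∀ x, j x < N)
    (m : ℕ) :
    Computes (2 * N + 5) (2 * m)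
      {fun x => (i x : ℝ), fun x => (j x : ℝ), fun x => (g x : ℝ)}
      {fun x => (i x : ℝ), fun x => (j x : ℝ), fun x => (g x : ℝ),
        fun x => ∑ γ ∈ Finset.range m, if g x = γ then ρ γ (i x) (j x) else 0} := by
  induction m with
  | zero =>
    simp only [Finset.range_zero, Finset.sum_empty, Nat.mul_zero]
    rintro f (rfl | rfl | rfl | rfl)
    iterate 3 exact affSpan.of_mem (by simp)
    exact affSpan.const 0
  | succ m ih =>
    have h := ih.trans (computes_slice (ρ m) (hρ0 m) (hρ1 m) m i j g hi hj
      (fun x => ∑ γ ∈ Finset.range m, if g x = γ then ρ γ (i x) (j x) else 0)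
      fun x => Finset.sum_nonneg fun γ _ => by split_ifs <;> [exact hρ0 _ _ _; exact le_rfl])
    simp only [Finset.sum_range_succ]
    exact h

/-- The leading base-`b` digit of `d` is split off and multiplied by `z`. -/
theorem computes_mulDigit {b c : ℕ} (hb : 1 ≤ b) (hc : 0 < c) {d : X → ℕ} {z a : X → ℝ}
    (hz0 : ∀ x, 0 ≤ z x) (hz1 : ∀ x, z x ≤ 1) (ha : ∀ x, 0 ≤ a x) (hd : ∀ x, d x < b * c) :
    Computes (2 * b + 3) 2 {fun x => (d x : ℝ), z, a}
      {fun x => ((d x % c : ℕ) : ℝ), z, fun x => a x + c * (z x * (d x / c : ℕ))} := by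
  set y : X → ℝ := fun x => (d x : ℝ) with hy
  set r1 : ℕ → X → ℝ := fun j x => y x - ((j + 1) * c : ℕ) + 1 with hr1
  set r2 : ℕ → X → ℝ := fun j x => y x - ((j + 1) * c : ℕ) with hr2
  set l : List (X → ℝ) := [y, z, a] ++
    ((List.range (b - 1)).map r1 ++ (List.range (b - 1)).map r2) with hl
  have hyl : y ∈ affSpan (reluSet l) :=
    affSpan.relu_mem_of_nonneg (by simp [hl]) fun x => Nat.cast_nonneg _
  have hzl : z ∈ affSpan (reluSet l) := affSpan.relu_mem_of_nonneg (by simp [hl]) hz0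
  have hal : a ∈ affSpan (reluSet l) := affSpan.relu_mem_of_nonneg (by simp [hl]) ha
  have hind : ∀ j < b - 1, (fun x => if (j + 1) * c ≤ d x then (1 : ℝ) else 0)
      ∈ affSpan (reluSet l) := by
    intro j hj
    have m1 : r1 j ∈ l := by
      simp only [hl, List.mem_append, List.mem_map, List.mem_range]
      exact Or.inr (Or.inl ⟨j, hj, rfl⟩)
    have m2 : r2 j ∈ l := by
      simp only [hl, List.mem_append, List.mem_map, List.mem_range]
      exact Or.inr (Or.inr ⟨j, hj, rfl⟩)
    refine affSpan.congr (affSpan.sub (affSpan.relu_mem m1) (affSpan.relu_mem m2)) fun x => ?_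
    rw [← ramp_eq (f := 0) (η := 1) one_pos le_rfl (by norm_num)]
    simp [hr1, hr2, hy]
  have hq : (fun x => ((d x / c : ℕ) : ℝ)) ∈ affSpan (reluSet l) :=
    affSpan.congr (affSpan.sum (Finset.range (b - 1)) fun j hj => hind j (Finset.mem_range.1 hj))
      fun x => (sum_range_ite_digit b c (d x) hb hc (hd x)).symm
  set y' : X → ℝ := fun x => ((d x % c : ℕ) : ℝ) with hy'
  have hy'l : y' ∈ affSpan (reluSet l) := by
    refine affSpan.congr (affSpan.sub hyl (affSpan.const_mul (c : ℝ) hq)) fun x => ?_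
    have : (d x : ℝ) = c * (d x / c : ℕ) + (d x % c : ℕ) := by
      exact_mod_cast (Nat.div_add_mod (d x) c).symm
    simp only [hy, hy']
    linarith
  set ψ : ℕ → X → ℝ := fun j x => z x + (if (j + 1) * c ≤ d x then (1 : ℝ) else 0) - 1 with hψ
  set l' : List (X → ℝ) := [y', z, a] ++ (List.range (b - 1)).map ψ with hl'
  have hA : ReluStep (2 * b + 3) {y, z, a} (affSpan (reluSet l)) := by
    refine ⟨l, by simp [hl]; omega, ?_, le_rfl⟩
    intro f hf
    simp only [hl, List.mem_append, List.mem_map, List.mem_range, List.mem_cons,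
      List.not_mem_nil, or_false] at hf
    have hyS : y ∈ affSpan {y, z, a} := affSpan.of_mem (by simp)
    rcases hf with (rfl | rfl | rfl) | ⟨j, -, rfl⟩ | ⟨j, -, rfl⟩
    iterate 3 exact affSpan.of_mem (by simp)
    · exact affSpan.add (affSpan.sub hyS (affSpan.const _)) (affSpan.const _)
    · exact affSpan.sub hyS (affSpan.const _)
  have hB : ReluStep (2 * b + 3) (affSpan (reluSet l) : Set (X → ℝ))
      {y', z, fun x => a x + c * (z x * (d x / c : ℕ))} := by
    refine ⟨l', by simp [hl']; omega, ?_, ?_⟩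
    · intro f hf
      refine affSpan.of_mem ?_
      simp only [hl', List.mem_append, List.mem_map, List.mem_range, List.mem_cons,
        List.not_mem_nil, or_false] at hf
      rcases hf with (rfl | rfl | rfl) | ⟨t, ht, rfl⟩
      · exact hy'l
      · exact hzl
      · exact hal
      · exact affSpan.sub (affSpan.add hzl (hind t ht)) (affSpan.const 1)
    · rintro f (rfl | rfl | rfl)
      · exact affSpan.relu_mem_of_nonneg (by simp [hl']) fun x => Nat.cast_nonneg _
      · exact affSpan.relu_mem_of_nonneg (by simp [hl']) hz0
      · refine affSpan.congr (affSpan.add (affSpan.relu_mem_of_nonneg (f := a) (l := l')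
          (by simp [hl']) ha) (affSpan.const_mul (c : ℝ) (affSpan.sum (Finset.range (b - 1))
            (F := fun t x => relu (ψ t x)) fun t ht => affSpan.relu_mem ?_))) fun x => ?_
        · simp only [hl', List.mem_append, List.mem_map, List.mem_range]
          exact Or.inr ⟨t, Finset.mem_range.1 ht, rfl⟩
        · rw [← sum_range_ite_digit b c (d x) hb hc (hd x), Finset.mul_sum]
          congr 2
          refine Finset.sum_congr rfl fun j _ => ?_
          simp only [hψ]
          split_ifs
          · rw [add_sub_cancel_right, mul_one, relu_of_nonneg (hz0 x)]
          · rw [mul_zero, relu_of_nonpos (by linarith [hz1 x])]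
  exact ⟨_, hA, _, hB, fun f hf => affSpan.of_mem hf⟩

/-- Exact multiplication of a function with values in `[0, 1]` by an integer-valued function. -/
theorem computes_mul {b : ℕ} (hb : 1 ≤ b) (n : ℕ) {d : X → ℕ} {z : X → ℝ} (a : X → ℝ)
    (hz0 : ∀ x, 0 ≤ z x) (hz1 : ∀ x, z x ≤ 1) (ha : ∀ x, 0 ≤ a x) (hd : ∀ x, d x < b ^ n) :
    Computes (2 * b + 3) (2 * n) {fun x => (d x : ℝ), z, a} {fun x => a x + z x * d x} := by
  induction n generalizing d a with
  | zero =>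
    have h0 : ∀ x, d x = 0 := fun x => by simpa using hd x
    simp only [h0, Nat.cast_zero, add_zero, mul_zero]
    rintro f rfl
    exact affSpan.of_mem (by simp)
  | succ n ih =>
    have hc : 0 < b ^ n := by positivity
    have h := (computes_mulDigit hb hc hz0 hz1 ha (fun x => by rw [← pow_succ']; exact hd x)).trans
      (ih (d := fun x => d x % b ^ n)
        (fun x => a x + (b ^ n : ℕ) * (z x * (d x / b ^ n : ℕ)))
        (fun x => add_nonneg (ha x) (mul_nonneg (by positivity)
          (mul_nonneg (hz0 x) (by positivity)))) (fun x => Nat.mod_lt _ hc))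
    rw [show 2 + 2 * n = 2 * (n + 1) by ring] at h
    convert h using 2
    ext x
    have : (d x : ℝ) = (b ^ n : ℕ) * (d x / b ^ n : ℕ) + (d x % b ^ n : ℕ) := by
      exact_mod_cast (Nat.div_add_mod (d x) (b ^ n)).symm
    rw [this]; ring

end Lookup

theorem Computes.weaken {X : Type} {S S' T T' : Set (X → ℝ)} {w w' n : ℕ}
    (h : Computes w n S T) (hw : w ≤ w') (hS : S ⊆ affSpan S') (hT : T' ⊆ affSpan T) :
    Computes w' n S' T' :=
  ((h.mono_width hw).mono_left hS).mono_right hT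

section Cells

variable {X : Type}

/-- A table of `N ^ 2 * ℓ ^ 2` integers with `n` digits in base `b` is read off. -/
theorem computes_table {N b ℓ e n : ℕ} (hNb : N < b) (hN : 0 < N) (hℓ : 0 < ℓ)
    (he : N * ℓ ≤ b ^ e) (tbl : ℕ → ℕ) (htbl : ∀ m, tbl m < b ^ n) (m : X → ℕ)
    (hm : ∀ x, m x < N * ℓ * (N * ℓ)) :
    Computes (2 * b + 5) (6 * e + ℓ * (n + 3)) {fun x => (m x : ℝ)}
      {fun x => (tbl (m x) : ℝ)} := by
  have hb : 1 ≤ b := by omega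
  have hb2 : N * ℓ * (N * ℓ) ≤ b ^ (2 * e) := by
    rw [two_mul, pow_add]; exact Nat.mul_le_mul he he
  have hmb : ∀ x, m x < b ^ (2 * e) := fun x => (hm x).trans_le hb2
  set k : X → ℕ := fun x => m x % ℓ with hk
  set i : X → ℕ := fun x => m x / ℓ % N with hi
  set j : X → ℕ := fun x => m x / ℓ / N % N with hj
  set g : X → ℕ := fun x => m x / ℓ / N / N with hg
  have hg' : ∀ x, g x < ℓ := by
    intro x
    rw [hg]
    dsimp only
    rw [Nat.div_div_eq_div_mul, Nat.div_div_eq_div_mul, Nat.div_lt_iff_lt_mul (by positivity)]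
    calc m x < N * ℓ * (N * ℓ) := hm x
      _ = ℓ * (ℓ * (N * N)) := by ring
  have s1 : Computes (2 * b) (2 * e) {fun x => (m x : ℝ)}
      {fun x => ((m x / ℓ : ℕ) : ℝ), fun x => (k x : ℝ)} := by
    have := computes_divMod hb (2 * e) (c := ℓ) (d := fun x => m x / ℓ) (r := k)
      (fun x => Nat.mod_lt _ hℓ) fun x => (Nat.div_le_self _ _).trans_lt (hmb x)
    simpa only [hk, Nat.div_add_mod'] using this
  have s2 : Computes (2 * b) (2 * e) {fun x => ((m x / ℓ : ℕ) : ℝ)}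
      {fun x => ((m x / ℓ / N : ℕ) : ℝ), fun x => (i x : ℝ)} := by
    have := computes_divMod hb (2 * e) (c := N) (d := fun x => m x / ℓ / N) (r := i)
      (fun x => Nat.mod_lt _ hN) fun x => (Nat.div_le_self _ _).trans_lt
        ((Nat.div_le_self _ _).trans_lt (hmb x))
    simpa only [hi, Nat.div_add_mod'] using this
  have s3 : Computes (2 * b) (2 * e) {fun x => ((m x / ℓ / N : ℕ) : ℝ)}
      {fun x => (g x : ℝ), fun x => (j x : ℝ)} := by
    have := computes_divMod hb (2 * e) (c := N) (d := g) (r := j)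
      (fun x => Nat.mod_lt _ hN) fun x => (Nat.div_le_self _ _).trans_lt
        ((Nat.div_le_self _ _).trans_lt ((Nat.div_le_self _ _).trans_lt (hmb x)))
    simpa only [hg, hj, Nat.div_add_mod'] using this
  set kf : X → ℝ := fun x => (k x : ℝ) with hkf
  set iF : X → ℝ := fun x => (i x : ℝ) with hiF
  have hkf0 : ∀ f ∈ [kf], ∀ x, 0 ≤ f x := by
    intro f hf x
    obtain rfl : f = kf := by simpa using hf
    exact Nat.cast_nonneg _
  have hkif0 : ∀ f ∈ [kf, iF], ∀ x, 0 ≤ f x := by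
    intro f hf x
    rcases (by simpa using hf : f = kf ∨ f = iF) with rfl | rfl <;> exact Nat.cast_nonneg _
  set v : ℕ → ℕ → ℕ → ℕ → ℕ := fun γ i j t => tbl (((γ * N + j) * N + i) * ℓ + t) with hv
  have hB : 0 < b ^ n := by positivity
  have hY : ∀ γ i j l, ∑ t ∈ Finset.range l, v γ i j t * (b ^ n) ^ t < (b ^ n) ^ l := by
    intro γ i j l
    induction l with
    | zero => simp
    | succ l ih =>
      rw [Finset.sum_range_succ, pow_succ']
      calc _ < (b ^ n) ^ l + v γ i j l * (b ^ n) ^ l := by omega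
        _ = (v γ i j l + 1) * (b ^ n) ^ l := by ring
        _ ≤ b ^ n * (b ^ n) ^ l := Nat.mul_le_mul_right _ (htbl _)
  set ρ : ℕ → ℕ → ℕ → ℝ := fun γ i j =>
    ((∑ t ∈ Finset.range ℓ, v γ i j t * (b ^ n) ^ t : ℕ) : ℝ) / ((b ^ n) ^ ℓ : ℕ) with hρ
  have hpos : (0 : ℝ) < ((b ^ n) ^ ℓ : ℕ) := by exact_mod_cast pow_pos hB ℓ
  have s4 := (computes_lookup (N := N) ρ (fun _ _ _ => by positivity)
    (fun γ i j => by
      rw [hρ]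
      dsimp only
      rw [div_le_one hpos]
      exact_mod_cast (hY γ i j ℓ).le) i j g (fun x => Nat.mod_lt _ hN)
      (fun x => Nat.mod_lt _ hN) ℓ).carry [kf] hkf0
  have s5 := computes_readDigit hb n ℓ (fun t x => v (g x) (i x) (j x) t)
    (fun t x => htbl _) k (fun _ => 0) (fun _ => le_rfl)
  have h1 : Computes (2 * b + 5) (2 * e) {fun x => (m x : ℝ)} {fun x => ((m x / ℓ : ℕ) : ℝ), kf} :=
    s1.mono_width (by omega)
  have h2 : Computes (2 * b + 5) (2 * e) {fun x => ((m x / ℓ : ℕ) : ℝ), kf}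
      {fun x => ((m x / ℓ / N : ℕ) : ℝ), iF, kf} :=
    (s2.carry [kf] hkf0).weaken (by simp) (by
      rintro f (rfl | hf)
      · exact affSpan.of_mem (by simp)
      · exact affSpan.of_mem (by simpa using Or.inr hf)) (by
      rintro f (rfl | rfl | rfl) <;> exact affSpan.of_mem (by simp))
  have h3 : Computes (2 * b + 5) (2 * e) {fun x => ((m x / ℓ / N : ℕ) : ℝ), iF, kf}
      {fun x => (g x : ℝ), fun x => (j x : ℝ), iF, kf} :=
    (s3.carry [kf, iF] hkif0).weaken (by simp) (by
      rintro f (rfl | hf)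
      · exact affSpan.of_mem (by simp)
      · rcases (by simpa using hf : f = kf ∨ f = iF) with rfl | rfl <;>
          exact affSpan.of_mem (by simp)) (by
      rintro f (rfl | rfl | rfl | rfl) <;> exact affSpan.of_mem (by simp))
  have h4 : Computes (2 * b + 5) (2 * ℓ) {fun x => (g x : ℝ), fun x => (j x : ℝ), iF, kf}
      {fun x => ((∑ t ∈ Finset.range ℓ, v (g x) (i x) (j x) t * (b ^ n) ^ t : ℕ) : ℝ), kf,
        fun _ => 0} :=
    s4.weaken (by simp; omega) (by
      rintro f ((rfl | rfl | rfl) | hf)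
      · exact affSpan.of_mem (by simp [hiF])
      · exact affSpan.of_mem (by simp)
      · exact affSpan.of_mem (by simp)
      · exact affSpan.of_mem (by simpa using Or.inr (Or.inr (Or.inr hf)))) (by
      rintro f (rfl | rfl | rfl)
      · refine affSpan.congr (affSpan.const_mul (((b ^ n) ^ ℓ : ℕ) : ℝ)
          (affSpan.of_mem (f := fun x => ∑ γ ∈ Finset.range ℓ,
            if g x = γ then ρ γ (i x) (j x) else 0) (by simp))) fun x => ?_
        rw [Finset.sum_ite_eq, if_pos (Finset.mem_range.2 (hg' x)), hρ]
        dsimp only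
        rw [mul_div_cancel₀ _ hpos.ne']
      · exact affSpan.of_mem (by simp)
      · exact affSpan.const 0)
  have h5 : Computes (2 * b + 5) (ℓ * (n + 1))
      {fun x => ((∑ t ∈ Finset.range ℓ, v (g x) (i x) (j x) t * (b ^ n) ^ t : ℕ) : ℝ), kf,
        fun _ => 0} {fun x => (tbl (m x) : ℝ)} := by
    refine s5.weaken (by omega) (fun f hf => affSpan.of_mem hf) ?_
    rintro f rfl
    refine affSpan.congr (affSpan.of_mem (Set.mem_singleton _)) fun x => ?_
    have hkx : k x < ℓ := Nat.mod_lt _ hℓ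
    rw [zero_add, Finset.sum_ite_eq, if_pos (Finset.mem_range.2 hkx)]
    simp only [hv, hg, hj, hi, hk, Nat.div_add_mod']
  have := h1.trans (h2.trans (h3.trans (h4.trans h5)))
  convert this using 1
  ring

/-- A signed number `2 z - 1` is multiplied by a product of fractions with denominator `b ^ n`. -/
theorem computes_prod {p b n : ℕ} (hb : 1 ≤ b) (u : Fin p → X → ℕ)
    (hu : ∀ i x, u i x < b ^ n) (ls : List (Fin p)) (z : X → ℝ) (hz0 : ∀ x, 0 ≤ z x)
    (hz1 : ∀ x, z x ≤ 1) :
    Computes (2 * b + 3 + p) (2 * n * ls.length) ({z} ∪ Set.range fun i x => (u i x : ℝ))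
      {fun x => (2 * z x - 1) * (ls.map fun i => (u i x : ℝ) / (b : ℝ) ^ n).prod} := by
  induction ls generalizing z with
  | nil =>
    rintro f rfl
    refine affSpan.congr (affSpan.sub (affSpan.const_mul 2
      (affSpan.of_mem (f := z) (by simp))) (affSpan.const 1)) fun x => by simp
  | cons i ls ih =>
    have hB : (0 : ℝ) < (b : ℝ) ^ n := by
      have : (0 : ℝ) < b := by exact_mod_cast hb
      positivity
    set h : X → ℝ := fun x => (u i x : ℝ) / (b : ℝ) ^ n with hh
    have h0 : ∀ x, 0 ≤ h x := fun x => by positivity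
    have h1 : ∀ x, h x ≤ 1 := fun x => by
      rw [hh]
      dsimp only
      rw [div_le_one hB]
      exact_mod_cast (hu i x).le
    set z' : X → ℝ := fun x => z x * h x + (1 - h x) / 2 with hz'
    have hz'0 : ∀ x, 0 ≤ z' x := fun x => by
      have := mul_nonneg (hz0 x) (h0 x)
      have := h1 x
      simp only [hz']
      linarith
    have hz'1 : ∀ x, z' x ≤ 1 := fun x => by
      have := mul_le_mul_of_nonneg_right (hz1 x) (h0 x)
      have := h1 x
      have := h0 x
      simp only [hz']
      linarith
    have := ih z' hz'0 hz'1
    have hstep : Computes (2 * b + 3 + p) (2 * n) ({z} ∪ Set.range fun i x => (u i x : ℝ))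
        ({z'} ∪ Set.range fun i x => (u i x : ℝ)) := by
      set l : List (X → ℝ) := List.ofFn fun i x => (u i x : ℝ) with hl
      have hlmem : ∀ f, f ∈ l ↔ f ∈ Set.range fun i x => (u i x : ℝ) := fun f => by
        rw [hl, List.mem_ofFn']
      have hc := (computes_mul hb n (fun _ => 0) hz0 hz1 (fun _ => le_rfl) (hu i)).carry l (by
        intro f hf x
        obtain ⟨i, rfl⟩ := (hlmem f).1 hf
        exact Nat.cast_nonneg _)
      refine hc.weaken (by simp [hl]) ?_ ?_
      · rintro f ((rfl | rfl | rfl) | hf)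
        · exact affSpan.of_mem (Or.inr ⟨i, rfl⟩)
        · exact affSpan.of_mem (Or.inl rfl)
        · exact affSpan.const 0
        · exact affSpan.of_mem (Or.inr ((hlmem f).1 hf))
      · rintro f (rfl | hf)
        · refine affSpan.congr (affSpan.add (affSpan.div_const ((b : ℝ) ^ n)
            (affSpan.of_mem (f := fun x => 0 + z x * (u i x : ℝ)) (Or.inl rfl)))
            (affSpan.sub (affSpan.const (1 / 2)) (affSpan.div_const (2 * (b : ℝ) ^ n)
            (affSpan.of_mem (f := fun x => (u i x : ℝ)) (Or.inr ((hlmem _).2 ⟨i, rfl⟩))))))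
            fun x => ?_
          simp only [hz', hh]
          field_simp
          ring
        · exact affSpan.of_mem (Or.inr ((hlmem f).2 hf))
    rw [show 2 * n * (i :: ls).length = 2 * n + 2 * n * ls.length by
      simp only [List.length_cons]; ring]
    refine (hstep.trans this).mono_right ?_
    rintro f rfl
    refine affSpan.congr (affSpan.of_mem rfl) fun x => ?_
    simp only [List.map_cons, List.prod_cons, hz', hh]
    ring

/-- A monomial in the coordinates relative to the corner of a grid cell, with a coefficient
depending on the cell. -/
theorem computes_cellMonomial {p N b ℓ e n K W : ℕ} (hp : 0 < p) (hNb : N < b) (hN : 0 < N)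
    (hℓ : 0 < ℓ) (he : N * ℓ ≤ b ^ e) (hK : K ^ p ≤ N * ℓ * (N * ℓ))
    (hW1 : p * (2 * b) ≤ W) (hW2 : 2 * b + 5 + p ≤ W)
    (xi F : Fin p → X → ℝ) (q : X → Fin p → Fin K) (u : Fin p → X → ℕ)
    (hu : ∀ i x, u i x < b ^ n) {η c : ℝ} (hη : 0 < η) (hF0 : ∀ i x, 0 ≤ F i x)
    (hF1 : ∀ i x, F i x ≤ 1 - η)
    (hxi : ∀ i x, c * xi i x = ((q x i * b ^ n + u i x : ℕ) : ℝ) + F i x)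
    (v : (Fin p → Fin K) → ℕ) (hv : ∀ k, v k < b ^ n) (ls : List (Fin p)) :
    Computes W (10 * e + n + ℓ * (n + 3) + 2 * n * ls.length) (Set.range xi)
      {fun x => (2 * ((v (q x) : ℝ) / (b : ℝ) ^ n) - 1)
        * (ls.map fun i => (u i x : ℝ) / (b : ℝ) ^ n).prod} := by
  have hb : 1 ≤ b := by omega
  have hB : 0 < b ^ n := by positivity
  have hb2 : K ^ p ≤ b ^ (2 * e) := by
    rw [two_mul, pow_add]; exact hK.trans (Nat.mul_le_mul he he)
  have hqb : ∀ i x, (q x i : ℕ) < b ^ (2 * e) := fun i x =>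
    (q x i).2.trans_le ((Nat.le_self_pow hp.ne' K).trans hb2)
  have s1 : ∀ i, Computes (2 * b) (4 * e + n) (Set.range xi)
      {fun x => ((q x i : ℕ) : ℝ), fun x => (u i x : ℝ)} := by
    intro i
    have h1 := computes_floor hb (2 * e + n) (d := fun x => q x i * b ^ n + u i x) (f := F i)
      (a := fun _ => 0) hη (hF0 i) (hF1 i) (fun _ => le_rfl) (fun x => by
        rw [pow_add]
        calc q x i * b ^ n + u i x < (q x i + 1) * b ^ n := by
              have := hu i x
              rw [Nat.add_mul, one_mul]; omega
          _ ≤ b ^ (2 * e) * b ^ n := Nat.mul_le_mul_right _ (hqb i x))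
    have h2 := computes_divMod hb (2 * e) (c := b ^ n) (d := fun x => (q x i : ℕ)) (r := u i)
      (hu i) (hqb i)
    have h3 := (h1.weaken (S' := Set.range xi)
      (T' := {fun x => ((q x i * b ^ n + u i x : ℕ) : ℝ)}) le_rfl (by
      rintro f (rfl | rfl)
      · refine affSpan.congr (affSpan.const_mul c (affSpan.of_mem ⟨i, rfl⟩)) fun x => ?_
        rw [hxi]
      · exact affSpan.const 0) (by
      rintro f rfl
      exact affSpan.congr (affSpan.of_mem (Or.inr rfl)) fun x => by simp)).trans h2
    convert h3 using 1
    ring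
  have s1' := Computes.iUnion s1
  set m : X → ℕ := fun x => (finFunctionFinEquiv (q x) : ℕ) with hm
  set uL : List (X → ℝ) := List.ofFn fun i x => (u i x : ℝ) with huL
  have hmem : ∀ f, f ∈ uL ↔ f ∈ Set.range fun i x => (u i x : ℝ) := fun f => by
    rw [huL, List.mem_ofFn']
  set tbl : ℕ → ℕ := fun k => if h : k < K ^ p then v (finFunctionFinEquiv.symm ⟨k, h⟩) else 0
    with htbl
  have htbl_lt : ∀ k, tbl k < b ^ n := by
    intro k
    simp only [htbl]
    split_ifs
    · exact hv _
    · exact hB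
  have htbl_eq : ∀ x, tbl (m x) = v (q x) := by
    intro x
    simp only [htbl, hm]
    rw [dif_pos (Fin.is_lt _)]
    exact congrArg v (Equiv.symm_apply_apply finFunctionFinEquiv (q x))
  have s2 := (computes_table hNb hN hℓ he tbl htbl_lt m
    fun x => (Fin.is_lt (finFunctionFinEquiv (q x))).trans_le hK).carry uL (by
      intro f hf x
      obtain ⟨i, rfl⟩ := (hmem f).1 hf
      exact Nat.cast_nonneg _)
  have s3 := computes_prod hb u hu ls (fun x => (v (q x) : ℝ) / (b : ℝ) ^ n)
    (fun x => by positivity) (fun x => by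
      rw [div_le_one (by have : (0 : ℝ) < b := by exact_mod_cast hb
                         positivity)]
      exact_mod_cast (hv _).le)
  have t1 := s1'.mono_width (w' := W) (by simpa using hW1)
  have t2 := s2.weaken (w' := W) (S' := ⋃ i, {fun x => ((q x i : ℕ) : ℝ), fun x => (u i x : ℝ)})
    (T' := {fun x => (v (q x) : ℝ) / (b : ℝ) ^ n} ∪ Set.range fun i x => (u i x : ℝ))
    (by simpa [huL] using hW2) (by
      rintro f (rfl | hf)
      · refine affSpan.congr (affSpan.sum Finset.univ (F := fun i x => ((q x i : ℕ) : ℝ) * K ^ (i : ℕ))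
          fun i _ => affSpan.mul_const _ (affSpan.of_mem ?_)) fun x => ?_
        · exact Set.mem_iUnion.2 ⟨i, Or.inl rfl⟩
        · simp only [hm, finFunctionFinEquiv_apply]
          push_cast
          rfl
      · obtain ⟨i, rfl⟩ := (hmem f).1 hf
        exact affSpan.of_mem (Set.mem_iUnion.2 ⟨i, Or.inr rfl⟩)) (by
      rintro f (rfl | hf)
      · refine affSpan.congr (affSpan.div_const ((b : ℝ) ^ n) (affSpan.of_mem (Or.inl rfl)))
          fun x => ?_
        rw [htbl_eq]
      · exact affSpan.of_mem (Or.inr ((hmem f).2 hf)))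
  have := t1.trans (t2.trans (s3.mono_width (w' := W) (by omega)))
  convert this using 1
  ring

/-- A piecewise polynomial on the grid cells with quantized coefficients. -/
theorem computes_cellPolynomial {p N b ℓ e n K W M : ℕ} (hp : 0 < p) (hNb : N < b) (hN : 0 < N)
    (hℓ : 0 < ℓ) (he : N * ℓ ≤ b ^ e) (hK : K ^ p ≤ N * ℓ * (N * ℓ))
    (hW1 : p * (2 * b) ≤ W) (hW2 : 2 * b + 5 + p ≤ W)
    (xi F : Fin p → X → ℝ) (q : X → Fin p → Fin K) (u : Fin p → X → ℕ)
    (hu : ∀ i x, u i x < b ^ n) {η c : ℝ} (hη : 0 < η) (hF0 : ∀ i x, 0 ≤ F i x)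
    (hF1 : ∀ i x, F i x ≤ 1 - η)
    (hxi : ∀ i x, c * xi i x = ((q x i * b ^ n + u i x : ℕ) : ℝ) + F i x)
    {ι : Type} [Fintype ι] (v : ι → (Fin p → Fin K) → ℕ) (hv : ∀ α k, v α k < b ^ n)
    (ls : ι → List (Fin p)) (hls : ∀ α, (ls α).length ≤ M) (C : ι → ℝ) :
    Computes (Fintype.card ι * W) (10 * e + n + ℓ * (n + 3) + 2 * n * M) (Set.range xi)
      {fun x => ∑ α, C α * ((2 * ((v α (q x) : ℝ) / (b : ℝ) ^ n) - 1)
        * ((ls α).map fun i => (u i x : ℝ) / (b : ℝ) ^ n).prod)} := by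
  have h := Computes.iUnion (ι := ι) fun α => (computes_cellMonomial hp hNb hN hℓ he hK hW1 hW2
    xi F q u hu hη hF0 hF1 hxi (v α) (hv α) (ls α)).pad_singleton (by omega)
    (m := 10 * e + n + ℓ * (n + 3) + 2 * n * M)
    (Nat.add_le_add_left (Nat.mul_le_mul_left _ (hls α)) _)
  refine h.mono_right ?_
  rintro f rfl
  exact affSpan.sum Finset.univ fun α _ => affSpan.const_mul _
    (affSpan.of_mem (Set.mem_iUnion.2 ⟨α, rfl⟩))

end Cells

section Realization

variable {X : Type} {d : ℕ}

/-- The hidden activations of a bias-free network with weight matrices `Ws 1, Ws 2, …`. -/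
def hiddenState (Ws : ℕ → Matrix (Fin d) (Fin d) ℝ) : ℕ → (Fin d → ℝ) → Fin d → ℝ
  | 0, z => z
  | n + 1, z => fun k => relu ((Ws (n + 1)).mulVec (hiddenState Ws n z) k)

theorem hiddenState_succ' (Ws : ℕ → Matrix (Fin d) (Fin d) ℝ) (n : ℕ) (z : Fin d → ℝ) :
    hiddenState Ws (n + 1) z
      = hiddenState (fun k => Ws (k + 1)) n (fun k => relu ((Ws 1).mulVec z k)) := by
  induction n with
  | zero => rfl
  | succ n ih => rw [hiddenState, ih]; rfl

theorem vnetOut_succ (Ws : ℕ → Matrix (Fin d) (Fin d) ℝ) (z : Fin d → ℝ) (n : ℕ) :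
    vnetOut d relu Ws z (n + 1) = (Ws (n + 1)).mulVec (hiddenState Ws n z) := by
  induction n with
  | zero => simp [vnetOut, hiddenState]
  | succ n ih =>
    rw [vnetOut, ih, hiddenState]
    simp

theorem hiddenState_congr {Ws Ws' : ℕ → Matrix (Fin d) (Fin d) ℝ} {n : ℕ}
    (h : ∀ l, 1 ≤ l → l ≤ n → Ws l = Ws' l) (z : Fin d → ℝ) :
    hiddenState Ws n z = hiddenState Ws' n z := by
  induction n with
  | zero => rfl
  | succ n ih =>
    rw [hiddenState, hiddenState, h (n + 1) (by omega) le_rfl, ih fun l h1 h2 => h l h1 (by omega)]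

/-- Every function affine in `S` is a linear functional of the state `g` that only involves the
first `r + 1` coordinates. -/
def Represents (r : ℕ) (S : Set (X → ℝ)) (g : X → Fin d → ℝ) : Prop :=
  ∀ ψ ∈ affSpan S, ∃ a : Fin d → ℝ, (∀ k : Fin d, r + 1 ≤ (k : ℕ) → a k = 0) ∧
    ∀ x, ψ x = a ⬝ᵥ g x

theorem Represents.of_generators {r : ℕ} {S : Set (X → ℝ)} {g : X → Fin d → ℝ}
    (h : ∀ ψ ∈ insert 1 S, ∃ k : Fin d, (k : ℕ) < r + 1 ∧ ∀ x, ψ x = g x k) :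
    Represents r S g := by
  intro ψ hψ
  induction hψ using Submodule.span_induction with
  | mem ψ hψ =>
    obtain ⟨k, hk, hψk⟩ := h ψ hψ
    refine ⟨Pi.single k 1, fun j hj => Pi.single_eq_of_ne (fun h => by subst h; omega) _,
      fun x => ?_⟩
    rw [single_one_dotProduct, hψk]
  | zero => exact ⟨0, fun _ _ => rfl, fun x => by simp⟩
  | add f f' _ _ h1 h2 =>
    obtain ⟨a, ha, ha'⟩ := h1
    obtain ⟨b, hb, hb'⟩ := h2
    refine ⟨a + b, fun k hk => by simp [ha k hk, hb k hk], fun x => ?_⟩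
    rw [add_dotProduct, Pi.add_apply, ha', hb']
  | smul c f _ h1 =>
    obtain ⟨a, ha, ha'⟩ := h1
    refine ⟨c • a, fun k hk => by simp [ha k hk], fun x => ?_⟩
    rw [smul_dotProduct, Pi.smul_apply, ha']

theorem Computes.exists_weights {r n : ℕ} (hr : r < d) {S : Set (X → ℝ)} {φ : X → ℝ}
    (h : Computes r n S {φ}) {g : X → Fin d → ℝ} (hg : Represents r S g) :
    ∃ Ws : ℕ → Matrix (Fin d) (Fin d) ℝ,
      (∀ l (i j : Fin d), r + 1 ≤ (i : ℕ) ∨ r + 1 ≤ (j : ℕ) → Ws l i j = 0) ∧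
      ∀ x, (Ws (n + 1)).mulVec (hiddenState Ws n (g x)) ⟨0, by omega⟩ = φ x := by
  induction n generalizing S g with
  | zero =>
    obtain ⟨a, ha, haφ⟩ := hg φ (h rfl)
    refine ⟨fun _ i j => if (i : ℕ) = 0 then a j else 0, ?_, fun x => ?_⟩
    · rintro _ i j (hi | hj)
      · exact if_neg (by omega)
      · dsimp only
        rw [ha j hj, ite_self]
    · rw [haφ]; simp [Matrix.mulVec, hiddenState]
  | succ n ih =>
    obtain ⟨U, ⟨l, hl, hlS, hU⟩, hn⟩ := h
    obtain ⟨o, ho, ho'⟩ := hg _ (affSpan.const 1)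
    have hA : ∀ k : Fin l.length, ∃ a : Fin d → ℝ, (∀ k : Fin d, r + 1 ≤ (k : ℕ) → a k = 0) ∧
        ∀ x, l.get k x = a ⬝ᵥ g x := fun k => hg _ (hlS _ (List.get_mem l k))
    choose A hA hA' using hA
    set W : Matrix (Fin d) (Fin d) ℝ := fun i j =>
      if h : (i : ℕ) < l.length then A ⟨i, h⟩ j else if (i : ℕ) = r then o j else 0 with hW
    have hrow : ∀ (i : Fin d) (h : (i : ℕ) < l.length) x, W.mulVec (g x) i = l.get ⟨i, h⟩ x := by
      intro i h x
      rw [hA']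
      simp [Matrix.mulVec, hW, h]
    have hrow1 : ∀ x, W.mulVec (g x) ⟨r, hr⟩ = 1 := by
      intro x
      rw [ho' x]
      simp [Matrix.mulVec, hW, hl.not_gt]
    have hg' : Represents r (reluSet l) fun x k => relu (W.mulVec (g x) k) := by
      refine Represents.of_generators ?_
      rintro ψ (rfl | ⟨ψ, hψ, rfl⟩)
      · refine ⟨⟨r, hr⟩, Nat.lt_succ_self r, fun x => ?_⟩
        rw [hrow1, relu_of_nonneg zero_le_one, Pi.one_apply]
      · obtain ⟨k, rfl⟩ := List.get_of_mem hψ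
        refine ⟨⟨k, by omega⟩, by simp; omega, fun x => ?_⟩
        rw [hrow ⟨k, by omega⟩ k.2 x]
    obtain ⟨Ws, hWs, hWs'⟩ := ih hn fun ψ hψ => hg' ψ (affSpan.le_of_subset hU hψ)
    refine ⟨fun k => if k = 1 then W else Ws (k - 1), ?_, fun x => ?_⟩
    · intro k i j hij
      dsimp only
      split_ifs
      · rcases hij with hi | hj
        · simp only [hW]
          rw [dif_neg (by omega), if_neg (by omega)]
        · simp only [hW]
          split_ifs
          · exact hA _ _ hj
          · exact ho _ hj
          · rfl
      · exact hWs _ i j hij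
    · rw [← hWs', hiddenState_succ']
      dsimp only
      rw [if_neg (show n + 1 + 1 ≠ 1 by omega), if_pos rfl, Nat.add_sub_cancel]
      refine congrArg (fun v => (Ws (n + 1)).mulVec v ⟨0, by omega⟩) (hiddenState_congr ?_ _)
      intro k hk _
      rw [if_neg (by omega), Nat.add_sub_cancel]

end Realization

section Prompt

variable {d : ℕ}

/-- Word embeddings of the prompt encoding the first `r + 1` rows of `Ws 1, Ws 2, …`. -/
def weightWords (r : ℕ) (Ws : ℕ → Matrix (Fin d) (Fin d) ℝ) (j : ℕ) : Fin d → ℝ :=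
  if j % 2 = 0 then fun c => if (c : ℕ) = j % (2 * (r + 1)) / 2 then 1 else 0
  else fun c => if h : j % (2 * (r + 1)) / 2 < d then
    Ws (j / (2 * (r + 1)) + 1) ⟨j % (2 * (r + 1)) / 2, h⟩ c else 0

/-- Layer indices of the prompt encoding a sequence of weight matrices. -/
def weightLayers (r j : ℕ) : ℕ := 2 * (j / (2 * (r + 1))) + 1 + j % 2

theorem div_mod_prompt_index {r q t : ℕ} (ht : t < 2 * (r + 1)) :
    (2 * (r + 1) * q + t) / (2 * (r + 1)) = q ∧ (2 * (r + 1) * q + t) % (2 * (r + 1)) = t ∧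
      (2 * (r + 1) * q + t) % 2 = t % 2 := by
  refine ⟨?_, ?_, ?_⟩
  · rw [Nat.mul_add_div (by omega), Nat.div_eq_of_lt ht, Nat.add_zero]
  · rw [Nat.mul_add_mod, Nat.mod_eq_of_lt ht]
  · rw [mul_assoc, Nat.mul_add_mod]

theorem weightLayers_apply {r q t : ℕ} (ht : t < 2 * (r + 1)) :
    weightLayers r (2 * (r + 1) * q + t) = 2 * q + 1 + t % 2 := by
  obtain ⟨e1, _, e3⟩ := div_mod_prompt_index (q := q) ht
  rw [weightLayers, e1, e3]

theorem weightWords_apply {r q t : ℕ} (ht : t < 2 * (r + 1))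
    (Ws : ℕ → Matrix (Fin d) (Fin d) ℝ) (c : Fin d) :
    weightWords r Ws (2 * (r + 1) * q + t) c = if t % 2 = 0 then (if (c : ℕ) = t / 2 then 1 else 0)
      else if h : t / 2 < d then Ws (q + 1) ⟨t / 2, h⟩ c else 0 := by
  obtain ⟨e1, e2, e3⟩ := div_mod_prompt_index (q := q) ht
  simp only [weightWords, e1, e2, e3]
  split_ifs with h1 h2 h2
  · exact if_pos h2
  · exact if_neg h2
  · rfl
  · rfl

theorem WPmat_weightWords {r L : ℕ} {Ws : ℕ → Matrix (Fin d) (Fin d) ℝ}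
    (hWs : ∀ l (i j : Fin d), r + 1 ≤ (i : ℕ) ∨ r + 1 ≤ (j : ℕ) → Ws l i j = 0) {l : ℕ}
    (hl : 1 ≤ l) (hlL : l ≤ L) :
    WPmat (T := 2 * (r + 1) * L) (fun j => weightWords r Ws j) (fun j => weightLayers r j) l
      = Ws l := by
  have hterm : ∀ j : Fin (2 * (r + 1) * L), ∀ a c : Fin d,
      (if h : (j : ℕ) + 1 < 2 * (r + 1) * L then
        (if weightLayers r j = 2 * l - 1 ∧ weightLayers r (j + 1) = 2 * l then
          vecMulVec (weightWords r Ws j) (weightWords r Ws (j + 1)) else 0)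
      else 0 : Matrix (Fin d) (Fin d) ℝ) a c
      = if (j : ℕ) = 2 * (r + 1) * (l - 1) + 2 * a then Ws l a c else 0 := by
    rintro ⟨j, hj⟩ a c
    dsimp only
    obtain ⟨q, t, htlt, rfl⟩ : ∃ q t, t < 2 * (r + 1) ∧ j = 2 * (r + 1) * q + t :=
      ⟨_, _, Nat.mod_lt j (by omega), (Nat.div_add_mod j (2 * (r + 1))).symm⟩
    have hmul : ∀ s, 2 * (r + 1) * s = 2 * ((r + 1) * s) := fun s => by ring
    have hM := hmul q
    have hM' := hmul L
    have hM'' := hmul (l - 1)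
    rcases Nat.mod_two_eq_zero_or_one t with h0 | h1
    · have htlt' : t + 1 < 2 * (r + 1) := by omega
      have hlt : 2 * (r + 1) * q + t + 1 < 2 * (r + 1) * L := by omega
      have htd : (t + 1) % 2 = 1 := by omega
      have hiff : (2 * (r + 1) * q + t = 2 * (r + 1) * (l - 1) + 2 * a) ∧ (a : ℕ) < r + 1 ↔
          q + 1 = l ∧ (a : ℕ) = t / 2 := by
        constructor
        · rintro ⟨h, ha⟩
          have g := div_mod_prompt_index (r := r) (q := l - 1) (t := 2 * a) (by omega)
          have e := div_mod_prompt_index (q := q) htlt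
          rw [← h, e.1, e.2.1] at g
          omega
        · rintro ⟨h, h'⟩
          obtain rfl : l - 1 = q := by omega
          omega
      have hl1 : weightLayers r (2 * (r + 1) * q + t) = 2 * q + 1 := by
        rw [weightLayers_apply htlt]; omega
      have hl2 : weightLayers r (2 * (r + 1) * q + t + 1) = 2 * q + 2 := by
        have := weightLayers_apply (q := q) htlt'
        rw [← add_assoc] at this
        omega
      have hw2 := weightWords_apply (q := q) htlt' Ws c
      rw [← add_assoc, if_neg (show ¬(t + 1) % 2 = 0 by omega)] at hw2
      have hw1 := weightWords_apply (q := q) htlt Ws a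
      rw [if_pos h0] at hw1
      rw [dif_pos hlt, hl1, hl2]
      trans if q + 1 = l ∧ (a : ℕ) = t / 2 then Ws l a c else 0
      · by_cases hq : q + 1 = l
        · subst hq
          rw [if_pos (by omega), vecMulVec_apply, hw1, hw2]
          by_cases ha : (a : ℕ) = t / 2
          · rw [if_pos ha, if_pos ⟨rfl, ha⟩, one_mul, dif_pos (by have := a.2; omega)]
            congr 1
            ext
            simp only [ha]
            omega
          · rw [if_neg ha, if_neg fun h => ha h.2, zero_mul]
        · rw [if_neg (by omega), if_neg fun h => hq h.1]
          rfl
      · rw [if_congr hiff.symm rfl rfl]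
        by_cases ha : (a : ℕ) < r + 1
        · simp only [ha, and_true]
        · rw [hWs l a c (Or.inl (by omega)), ite_self, ite_self]
    · rw [if_neg (show ¬2 * (r + 1) * q + t = 2 * (r + 1) * (l - 1) + 2 * a by omega)]
      split_ifs with h h'
      · rw [weightLayers_apply htlt] at h'
        omega
      · rfl
      · rfl
  ext a c
  rw [WPmat, Matrix.sum_apply]
  rw [Finset.sum_congr rfl fun j _ => hterm j a c]
  by_cases ha : (a : ℕ) < r + 1
  · have hlt : 2 * (r + 1) * (l - 1) + 2 * a < 2 * (r + 1) * L := by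
      calc _ < 2 * (r + 1) * (l - 1) + 2 * (r + 1) := by omega
        _ = 2 * (r + 1) * l := by
          rw [← Nat.mul_succ, Nat.succ_eq_add_one, Nat.sub_add_cancel hl]
        _ ≤ _ := Nat.mul_le_mul_left _ hlL
    rw [Finset.sum_eq_single (⟨_, hlt⟩ : Fin (2 * (r + 1) * L))]
    · simp
    · intro j _ hj
      rw [if_neg fun h => hj (Fin.ext h)]
    · simp
  · rw [hWs l a c (Or.inl (by omega))]
    simp

theorem WPfam_weightWords {r L : ℕ} {Ws : ℕ → Matrix (Fin d) (Fin d) ℝ}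
    (hWs : ∀ l (i j : Fin d), r + 1 ≤ (i : ℕ) ∨ r + 1 ≤ (j : ℕ) → Ws l i j = 0) {l : ℕ}
    (hl : 1 ≤ l) (hlL : l ≤ L) (i : ℕ) :
    WPfam (T := 2 * (r + 1) * L) (fun j => weightWords r Ws j) (fun j => weightLayers r j) i l
      = Ws l := by
  have hcorr : WPcorr (T := 2 * (r + 1) * L) (fun j => weightWords r Ws j)
      (fun j => weightLayers r j) = 0 := by
    rw [WPcorr]
    split_ifs with h h'
    · dsimp only at h'
      rw [weightLayers] at h'
      have : 2 * (r + 1) * L = 2 * ((r + 1) * L) := by ring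
      omega
    · rfl
    · rfl
  rw [WPfam]
  split_ifs with h1
  · subst h1
    rw [WPone, hcorr, ite_self, add_zero, WPmat_weightWords hWs hl hlL]
  · exact WPmat_weightWords hWs hl hlL

/-- Every ReLU network of width `r` with `n < L` hidden layers on the unit cube is realized by a
prompt of length `2 (r + 1) L`. -/
theorem exists_prompt {p r L n : ℕ} (hp : p ≤ r) (hr : r < d) (hr2 : 2 ≤ r) (hnL : n + 1 ≤ L)
    (Θ : List (TFLayer (4 * d + 8))) (hΘ : EmulatesWith d (tfForward Θ) relu)
    {φ : unitCube p → ℝ}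
    (h : Computes r n (Set.range fun (i : Fin p) (x : unitCube p) => x.1 i) {φ}) :
    ∃ (S : ℝ) (u : Fin (2 * (r + 1) * L) → Fin d → ℝ) (w : Fin (2 * (r + 1) * L) → ℕ),
      0 < S ∧ ValidPrompt (spanFirst d (r + 1)) (2 * (r + 1) * L) L u w ∧
        ∀ x : unitCube p, fhat (tfForward Θ) u w S L p x.1 = φ x := by
  obtain ⟨n, rfl⟩ : ∃ k, L = k + 1 := ⟨L - 1, by omega⟩
  have h' := h.pad_singleton hr2 (m := n) (by omega)
  obtain ⟨Ws, hWs, hφ⟩ := h'.exists_weights hr (g := fun x => embed d p x.1)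
    (Represents.of_generators (by
      rintro ψ (rfl | ⟨i, rfl⟩)
      · exact ⟨⟨p, by omega⟩, by simp; omega, fun x => by simp [embed]⟩
      · exact ⟨⟨i, by omega⟩, by simp; omega, fun x => by simp [embed]⟩))
  set T := 2 * (r + 1) * (n + 1) with hT
  set u : Fin T → Fin d → ℝ := fun j => weightWords r Ws j with hu
  set w : Fin T → ℕ := fun j => weightLayers r j with hw
  have hT0 : 0 < T := by positivity
  have hw' : ∀ j, 1 ≤ w j ∧ w j ≤ 2 * (n + 1) := by
    intro j
    have : (j : ℕ) / (2 * (r + 1)) < n + 1 := by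
      rw [Nat.div_lt_iff_lt_mul (by omega), mul_comm]; exact j.2
    simp only [hw, weightLayers]
    omega
  set B : ℝ := 1 + ∑ j, Real.sqrt (∑ k, u j k ^ 2) with hB
  have hB1 : 1 ≤ B := by
    have : 0 ≤ ∑ j, Real.sqrt (∑ k, u j k ^ 2) := Finset.sum_nonneg fun _ _ => Real.sqrt_nonneg _
    linarith
  set S : ℝ := max ((d : ℝ) * B ^ (4 * (n + 1)) * (T : ℝ) ^ (2 * (n + 1)))
    (2 * ((n + 1 : ℕ) : ℝ)) with hS
  have hU : Set.range u ⊆ eball d B := by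
    rintro _ ⟨j, rfl⟩
    have := Finset.single_le_sum (f := fun j => Real.sqrt (∑ k, u j k ^ 2))
      (fun _ _ => Real.sqrt_nonneg _) (Finset.mem_univ j)
    simp only [eball, Set.mem_ofPred_eq]
    linarith
  refine ⟨S, u, w, lt_of_lt_of_le (by positivity) (le_max_right _ _), ⟨fun j k hk => ?_, hw'⟩,
    fun x => ?_⟩
  · have hjt : (j : ℕ) % (2 * (r + 1)) < 2 * (r + 1) := Nat.mod_lt _ (by omega)
    simp only [hu, weightWords]
    split_ifs with h1
    · exact if_neg (by
        generalize (j : ℕ) % (2 * (r + 1)) = t at hjt ⊢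
        omega)
    · exact hWs _ _ _ (Or.inr hk)
    · rfl
  · have key := hΘ B hB1 T (n + 1) hT0 (by omega) _ hU S le_rfl u w
      ⟨fun j => ⟨j, rfl⟩, hw'⟩ 1 one_pos (fun _ => embed d p x.1) (fun _ k => by
        have hx := x.2
        simp only [embed]
        split_ifs
        · exact ⟨hx.1 _, hx.2 _⟩
        · simp
        · simp) 0 (n + 1) (by omega) le_rfl
    rw [fhat, show T + 1 + (n + 1) = T + 1 * (n + 1) + ((0 : Fin 1) : ℕ) + 1 by simp; ring, key,
      promptToken, dif_pos (show 0 < d by omega), vnetOut_succ, ← hφ,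
      WPfam_weightWords hWs (by omega) le_rfl]
    exact congrArg (fun v => (Ws (n + 1)).mulVec v ⟨0, by omega⟩)
      (hiddenState_congr (fun l h1 h2 => WPfam_weightWords hWs h1 (by omega) _) _)

end Prompt

section Median

/-- The median of three real numbers. -/
def mid (a b c : ℝ) : ℝ := max (min a b) (min (max a b) c)

theorem abs_mid_sub_le {a b c v ε : ℝ}
    (h : |a - v| ≤ ε ∧ |b - v| ≤ ε ∨ |a - v| ≤ ε ∧ |c - v| ≤ ε ∨ |b - v| ≤ ε ∧ |c - v| ≤ ε) :
    |mid a b c - v| ≤ ε := by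
  simp only [abs_le, mid] at *
  rcases le_total a b with h1 | h1 <;> simp only [h1, min_eq_left, min_eq_right, max_eq_left,
    max_eq_right] <;> rcases max_cases a (min b c) with h2 | h2 <;>
    rcases max_cases b (min a c) with h3 | h3 <;> rcases min_cases b c with h4 | h4 <;>
    rcases min_cases a c with h5 | h5 <;> constructor <;>
    rcases h with h | h | h <;> linarith

variable {X : Type}

theorem computes_mid (a b c : X → ℝ) :
    Computes 6 3 {a, b, c} {fun x => mid (a x) (b x) (c x)} := by
  have hs1 : ∀ s t : ℝ, min s t = t - relu (t - s) := fun s t => by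
    rcases le_total s t with h | h
    · rw [min_eq_left h, relu_of_nonneg (by linarith)]; ring
    · rw [min_eq_right h, relu_of_nonpos (by linarith)]; ring
  have hs2 : ∀ s t : ℝ, max s t = t + relu (s - t) := fun s t => by
    rcases le_total s t with h | h
    · rw [max_eq_right h, relu_of_nonpos (by linarith)]; ring
    · rw [max_eq_left h, relu_of_nonneg (by linarith)]; ring
  refine ⟨{fun x => min (a x) (b x), fun x => max (a x) (b x), c},
    ⟨[fun x => a x - b x, fun x => b x - a x, b, fun x => -b x, c, fun x => -c x], by simp, ?_, ?_⟩,
    {fun x => min (a x) (b x), fun x => min (max (a x) (b x)) (c x)},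
    ⟨[fun x => min (a x) (b x), fun x => -min (a x) (b x), c, fun x => -c x,
      fun x => c x - max (a x) (b x)], by simp, ?_, ?_⟩, Computes.mono_width (w := 3)
      (ReluStep.computes ⟨[fun x => min (a x) (b x) - min (max (a x) (b x)) (c x),
        fun x => min (max (a x) (b x)) (c x), fun x => -min (max (a x) (b x)) (c x)],
        by simp, ?_, ?_⟩) (by norm_num)⟩
  · have ha : a ∈ affSpan {a, b, c} := affSpan.of_mem (by simp)
    have hb : b ∈ affSpan {a, b, c} := affSpan.of_mem (by simp)
    have hc : c ∈ affSpan {a, b, c} := affSpan.of_mem (by simp)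
    simp only [List.mem_cons, List.not_mem_nil, or_false, forall_eq_or_imp, forall_eq]
    exact ⟨affSpan.sub ha hb, affSpan.sub hb ha, hb, affSpan.neg hb, hc, affSpan.neg hc⟩
  · simp only [Set.insert_subset_iff, Set.singleton_subset_iff, SetLike.mem_coe]
    refine ⟨?_, ?_, affSpan.relu_mem_of_neg_mem (by simp) (by simp)⟩
    · exact affSpan.congr (affSpan.sub (affSpan.relu_mem_of_neg_mem (f := b) (by simp) (by simp))
        (affSpan.relu_mem (f := fun x => b x - a x) (by simp))) fun x => hs1 _ _
    · exact affSpan.congr (affSpan.add (affSpan.relu_mem_of_neg_mem (f := b) (by simp) (by simp))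
        (affSpan.relu_mem (f := fun x => a x - b x) (by simp))) fun x => hs2 _ _
  · have ha : (fun x => min (a x) (b x)) ∈
        affSpan {fun x => min (a x) (b x), fun x => max (a x) (b x), c} :=
      affSpan.of_mem (by simp)
    have hb : (fun x => max (a x) (b x)) ∈
        affSpan {fun x => min (a x) (b x), fun x => max (a x) (b x), c} :=
      affSpan.of_mem (by simp)
    have hc : c ∈ affSpan {fun x => min (a x) (b x), fun x => max (a x) (b x), c} :=
      affSpan.of_mem (by simp)
    simp only [List.mem_cons, List.not_mem_nil, or_false, forall_eq_or_imp, forall_eq]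
    exact ⟨ha, affSpan.neg ha, hc, affSpan.neg hc, affSpan.sub hc hb⟩
  · simp only [Set.insert_subset_iff, Set.singleton_subset_iff, SetLike.mem_coe]
    refine ⟨affSpan.relu_mem_of_neg_mem (by simp) (by simp), ?_⟩
    exact affSpan.congr (affSpan.sub (affSpan.relu_mem_of_neg_mem (f := c) (by simp) (by simp))
      (affSpan.relu_mem (f := fun x => c x - max (a x) (b x)) (by simp))) fun x => hs1 _ _
  · have ha : (fun x => min (a x) (b x)) ∈
        affSpan {fun x => min (a x) (b x), fun x => min (max (a x) (b x)) (c x)} :=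
      affSpan.of_mem (by simp)
    have hb : (fun x => min (max (a x) (b x)) (c x)) ∈
        affSpan {fun x => min (a x) (b x), fun x => min (max (a x) (b x)) (c x)} :=
      affSpan.of_mem (by simp)
    simp only [List.mem_cons, List.not_mem_nil, or_false, forall_eq_or_imp, forall_eq]
    exact ⟨affSpan.sub ha hb, hb, affSpan.neg hb⟩
  · simp only [Set.singleton_subset_iff, SetLike.mem_coe]
    exact affSpan.congr (affSpan.add
      (affSpan.relu_mem_of_neg_mem (f := fun x => min (max (a x) (b x)) (c x)) (by simp) (by simp))
      (affSpan.relu_mem (f := fun x => min (a x) (b x) - min (max (a x) (b x)) (c x)) (by simp)))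
      fun x => hs2 _ _

/-- Iterated median over all ternary words of length `n`. -/
def iterMid : (n : ℕ) → ((Fin n → Fin 3) → ℝ) → ℝ
  | 0, a => a default
  | n + 1, a => mid (iterMid n fun s => a (Fin.cons 0 s)) (iterMid n fun s => a (Fin.cons 1 s))
      (iterMid n fun s => a (Fin.cons 2 s))

theorem abs_iterMid_sub_le {n : ℕ} {a : (Fin n → Fin 3) → ℝ} {v ε : ℝ}
    {good : Fin n → Fin 3 → Prop}
    (hgood : ∀ i, good i 0 ∧ good i 1 ∨ good i 0 ∧ good i 2 ∨ good i 1 ∧ good i 2)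
    (h : ∀ s, (∀ i, good i (s i)) → |a s - v| ≤ ε) : |iterMid n a - v| ≤ ε := by
  induction n with
  | zero => exact h _ fun i => i.elim0
  | succ n ih =>
    have key : ∀ j, good 0 j → |iterMid n (fun s => a (Fin.cons j s)) - v| ≤ ε := fun j hj =>
      ih (fun i => hgood i.succ) fun s hs => h _ fun i => by
        refine Fin.cases ?_ (fun i => ?_) i
        · simpa using hj
        · simpa using hs i
    refine abs_mid_sub_le ?_
    rcases hgood 0 with ⟨h1, h2⟩ | ⟨h1, h2⟩ | ⟨h1, h2⟩
    · exact Or.inl ⟨key _ h1, key _ h2⟩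
    · exact Or.inr (Or.inl ⟨key _ h1, key _ h2⟩)
    · exact Or.inr (Or.inr ⟨key _ h1, key _ h2⟩)

theorem computes_iterMid (n : ℕ) (a : (Fin n → Fin 3) → X → ℝ) :
    Computes (2 * 3 ^ n) (3 * n) (Set.range a) {fun x => iterMid n fun s => a s x} := by
  induction n with
  | zero =>
    rintro f rfl
    exact affSpan.of_mem ⟨default, rfl⟩
  | succ n ih =>
    have h1 : Computes (3 * (2 * 3 ^ n)) (3 * n) (Set.range a)
        (⋃ j : Fin 3, {fun x => iterMid n fun s => a (Fin.cons j s) x}) := by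
      have := Computes.iUnion (ι := Fin 3) (w := 2 * 3 ^ n) (n := 3 * n) (S := Set.range a)
        (T := fun j => {fun x => iterMid n fun s => a (Fin.cons j s) x}) fun j =>
          (ih fun s => a (Fin.cons j s)).mono_left (by
            rintro _ ⟨s, rfl⟩
            exact affSpan.of_mem ⟨_, rfl⟩)
      simpa using this
    have hpow : 1 ≤ 3 ^ n := Nat.one_le_pow _ _ (by norm_num)
    have hpow' : 3 ^ (n + 1) = 3 * 3 ^ n := by ring
    have h2 := h1.trans (((computes_mid _ _ _).mono_width (w' := 3 * (2 * 3 ^ n))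
      (by omega)).mono_left (S' := ⋃ j : Fin 3, {fun x => iterMid n fun s => a (Fin.cons j s) x}) (by
        rintro f (rfl | rfl | rfl)
        · exact affSpan.of_mem (Set.mem_iUnion.2 ⟨0, rfl⟩)
        · exact affSpan.of_mem (Set.mem_iUnion.2 ⟨1, rfl⟩)
        · exact affSpan.of_mem (Set.mem_iUnion.2 ⟨2, rfl⟩)))
    exact h2.mono_width (by omega)

theorem fract_shift_good {t η : ℝ} (h1 : η ≤ 1 / 3) :
    (Int.fract (t + η * 0) ≤ 1 - η ∧ Int.fract (t + η * 1) ≤ 1 - η) ∨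
    (Int.fract (t + η * 0) ≤ 1 - η ∧ Int.fract (t + η * 2) ≤ 1 - η) ∨
    (Int.fract (t + η * 1) ≤ 1 - η ∧ Int.fract (t + η * 2) ≤ 1 - η) := by
  have key : ∀ s : ℝ, 1 - η < Int.fract s →
      Int.fract (s + η) ≤ 1 - η ∧ Int.fract (s + η * 2) ≤ 1 - η := by
    intro s hs
    have hlt := Int.fract_lt_one s
    have e : ∀ k : ℝ, Int.fract (s + k) = Int.fract (Int.fract s + k - 1) := fun k => by
      rw [Int.fract_eq_fract]
      exact ⟨⌊s⌋ + 1, by push_cast; linarith [Int.self_sub_floor s]⟩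
    constructor
    · rw [e, Int.fract_eq_self.2 ⟨by linarith, by linarith⟩]; linarith
    · rw [e, Int.fract_eq_self.2 ⟨by linarith, by linarith⟩]; linarith
  by_cases ha : 1 - η < Int.fract (t + η * 0)
  · have := key _ ha
    refine Or.inr (Or.inr ⟨?_, ?_⟩)
    · convert this.1 using 2; ring
    · convert this.2 using 2; ring
  · by_cases hb : 1 - η < Int.fract (t + η * 1)
    · have := (key _ hb).1
      refine Or.inr (Or.inl ⟨not_lt.1 ha, ?_⟩)
      convert this using 2; ring
    · exact Or.inl ⟨not_lt.1 ha, not_lt.1 hb⟩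

/-- Approximations on the points of the cube away from the discontinuities of a grid, available for
arbitrarily small exceptional sets, yield approximations on the whole cube. -/
theorem exists_computes_of_grid {p w m : ℕ} (hw : 2 ≤ w) {f : unitCube p → ℝ} {K Q ε δ : ℝ}
    (hK : 0 ≤ K) (hQ : 0 < Q) (hδ : 0 < δ)
    (hf : ∀ ρ : ℝ, ∀ x y : unitCube p, (∀ i, |x.1 i - y.1 i| ≤ ρ) → |f x - f y| ≤ K * ρ)
    (h : ∀ η : ℝ, 0 < η → η ≤ 1 / 3 →
      ∃ φ : {x : unitCube p // ∀ i, Int.fract (Q * x.1 i) ≤ 1 - η} → ℝ,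
        Computes w m (Set.range fun (i : Fin p) x => x.1.1 i) {φ} ∧ ∀ x, |φ x - f x.1| ≤ ε) :
    ∃ ψ : unitCube p → ℝ,
      Computes (3 ^ p * w) (m + 3 * p) (Set.range fun (i : Fin p) (x : unitCube p) => x.1 i) {ψ} ∧
        ∀ x, |ψ x - f x| ≤ ε + δ := by
  obtain ⟨θ, hθ0, hθ1, hθ2, hθ3⟩ : ∃ θ : ℝ, 0 < θ ∧ Q * θ ≤ 1 / 3 ∧ θ ≤ 1 / 2 ∧ K * (2 * θ) ≤ δ := by
    refine ⟨min (1 / (3 * Q)) (min (1 / 2) (δ / (2 * (K + 1)))), by positivity, ?_, ?_, ?_⟩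
    · calc _ ≤ Q * (1 / (3 * Q)) := by gcongr; exact min_le_left _ _
        _ = 1 / 3 := by field_simp
    · exact (min_le_right _ _).trans (min_le_left _ _)
    · calc _ ≤ K * (2 * (δ / (2 * (K + 1)))) := by
            gcongr; exact (min_le_right _ _).trans (min_le_right _ _)
        _ = K / (K + 1) * δ := by field_simp
        _ ≤ 1 * δ := by gcongr; rw [div_le_one (by linarith)]; linarith
        _ = δ := one_mul δ
  obtain ⟨φ, hφ, hφf⟩ := h (Q * θ) (by positivity) hθ1
  set coords : Set (unitCube p → ℝ) := Set.range fun (i : Fin p) (x : unitCube p) => x.1 i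
    with hcoords
  obtain ⟨T', hT', hext⟩ := Computes.extend (S := coords) (Subtype.val : _ → unitCube p)
    (hφ.mono_left (S' := (fun f : unitCube p → ℝ => f ∘ Subtype.val) '' coords) (by
      rintro _ ⟨i, rfl⟩
      exact affSpan.of_mem ⟨_, ⟨i, rfl⟩, rfl⟩))
  obtain ⟨g, hg, hgφ⟩ := hext φ rfl
  have hg' : Computes w m coords {g} := hT'.mono_right (by
    rintro _ rfl
    exact affSpan.of_mem hg)
  have hbound : ∀ (s : Fin p → Fin 3) (x : unitCube p) (i : Fin p),
      |(2 * x.1 i - s i) * θ| ≤ 2 * θ ∧ 0 ≤ (1 - 2 * θ) * x.1 i + s i * θ ∧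
        (1 - 2 * θ) * x.1 i + s i * θ ≤ 1 := by
    intro s x i
    have hx0 : 0 ≤ x.1 i := x.2.1 i
    have hx1 : x.1 i ≤ 1 := x.2.2 i
    have hs : ((s i : ℕ) : ℝ) ≤ 2 := by exact_mod_cast Nat.le_of_lt_succ (s i).2
    have hs0 : (0 : ℝ) ≤ (s i : ℕ) := by positivity
    refine ⟨?_, ?_, ?_⟩
    · rw [abs_mul, abs_of_pos hθ0]
      refine mul_le_mul_of_nonneg_right ?_ hθ0.le
      rw [abs_le]
      constructor <;> linarith
    · have := mul_nonneg (show 0 ≤ 1 - 2 * θ by linarith) hx0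
      positivity
    · nlinarith
  set π : (Fin p → Fin 3) → unitCube p → unitCube p := fun s x =>
    ⟨fun i => (1 - 2 * θ) * x.1 i + s i * θ,
      fun i => (hbound s x i).2.1, fun i => (hbound s x i).2.2⟩ with hπ
  have hshift : ∀ s, Computes w m coords {g ∘ π s} := fun s => by
    refine ((hg'.comp (π s)).mono_left ?_).mono_right ?_
    · rintro _ ⟨_, ⟨i, rfl⟩, rfl⟩
      exact affSpan.congr (affSpan.add (affSpan.const_mul (1 - 2 * θ)
        (affSpan.of_mem (S := coords) ⟨i, rfl⟩)) (affSpan.const ((s i : ℕ) * θ))) fun x => rfl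
    · rintro _ rfl
      exact affSpan.of_mem ⟨g, rfl, rfl⟩
  refine ⟨fun x => iterMid p fun s => g (π s x), ?_, fun x => ?_⟩
  · have h1 := Computes.iUnion hshift
    rw [Fintype.card_fun, Fintype.card_fin, Fintype.card_fin] at h1
    refine h1.trans (((computes_iterMid p fun s x => g (π s x)).mono_width ?_).mono_left ?_)
    · rw [mul_comm]; exact Nat.mul_le_mul_left _ hw
    · rintro _ ⟨s, rfl⟩
      exact affSpan.of_mem (Set.mem_iUnion.2 ⟨s, rfl⟩)
  · refine abs_iterMid_sub_le
      (good := fun i j => Int.fract (Q * ((1 - 2 * θ) * x.1 i + (j : ℕ) * θ)) ≤ 1 - Q * θ)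
      (fun i => ?_) fun s hs => ?_
    · have := fract_shift_good (t := Q * ((1 - 2 * θ) * x.1 i)) (η := Q * θ) hθ1
      have e : ∀ j : ℝ, Q * ((1 - 2 * θ) * x.1 i) + Q * θ * j
        = Q * ((1 - 2 * θ) * x.1 i + j * θ) := fun j => by ring
      simp only [e] at this
      simpa using this
    · have h1 := hφf ⟨π s x, hs⟩
      rw [← hgφ] at h1
      have h2 := hf (2 * θ) (π s x) x fun i => by
        have := (hbound s x i).1
        rw [abs_sub_comm]
        convert this using 2
        simp only [hπ]
        ring
      simp only [Function.comp_apply] at h1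
      calc _ ≤ |g (π s x) - f (π s x)| + |f (π s x) - f x| := abs_sub_le _ _ _
        _ ≤ ε + δ := by linarith

end Median

section Taylor

/-- A Taylor estimate for a chain of successive derivatives on `[0,1]`. -/
theorem abs_sub_taylor_le {n : ℕ} {M : ℝ} {G : ℕ → ℝ → ℝ}
    (hG : ∀ k < n, ∀ t ∈ Set.Icc (0 : ℝ) 1, HasDerivWithinAt (G k) (G (k + 1) t) (Set.Icc 0 1) t)
    (hM : ∀ t ∈ Set.Icc (0 : ℝ) 1, |G n t| ≤ M) :
    ∀ t ∈ Set.Icc (0 : ℝ) 1,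
      |G 0 t - ∑ k ∈ Finset.range n, G k 0 * (t ^ k / k.factorial)| ≤ M * (t ^ n / n.factorial) := by
  induction n generalizing G with
  | zero => simpa using hM
  | succ n ih =>
    have hd : ∀ k : ℕ, ∀ t : ℝ, HasDerivAt (fun t : ℝ => t ^ (k + 1) / (k + 1).factorial)
        (t ^ k / k.factorial) t := fun k t => by
      refine ((hasDerivAt_pow (k + 1) t).div_const _).congr_deriv ?_
      rw [Nat.factorial_succ]
      have := Nat.factorial_ne_zero k
      push_cast
      field_simp
    have ih' := ih (G := fun k => G (k + 1)) (fun k hk => hG (k + 1) (by omega)) hM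
    have hderiv : ∀ t ∈ Set.Icc (0 : ℝ) 1, HasDerivWithinAt
        (fun t => G 0 t - ∑ k ∈ Finset.range (n + 1), G k 0 * (t ^ k / k.factorial))
        (G 1 t - ∑ k ∈ Finset.range n, G (k + 1) 0 * (t ^ k / k.factorial)) (Set.Icc 0 1) t := by
      intro t ht
      refine (hG 0 (by omega) t ht).sub ?_
      simp only [Finset.sum_range_succ', pow_zero]
      refine HasDerivWithinAt.add_const _ (HasDerivWithinAt.fun_sum fun k _ => ?_)
      exact ((hd k t).const_mul _).hasDerivWithinAt
    intro t ht
    rw [← Real.norm_eq_abs]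
    refine image_norm_le_of_norm_deriv_right_le_deriv_boundary'
      (f := fun t => G 0 t - ∑ k ∈ Finset.range (n + 1), G k 0 * (t ^ k / k.factorial))
      (f' := fun t => G 1 t - ∑ k ∈ Finset.range n, G (k + 1) 0 * (t ^ k / k.factorial))
      (a := 0) (b := 1) (B := fun t => M * (t ^ (n + 1) / (n + 1).factorial))
      (B' := fun t => M * (t ^ n / n.factorial))
      (fun s hs => (hderiv s hs).continuousWithinAt)
      (fun s hs => (hderiv s (Set.Ico_subset_Icc_self hs)).mono_of_mem_nhdsWithin
        (Icc_mem_nhdsGE_of_mem hs)) ?_ (by fun_prop)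
      (fun s _ => ((hd n s).const_mul M).hasDerivWithinAt)
      (fun s hs => ih' s (Set.Ico_subset_Icc_self hs)) ht
    simp [Finset.sum_range_succ']

variable {p β : ℕ} {f : (Fin p → ℝ) → ℝ}

theorem uniqueDiffOn_unitCube (p : ℕ) : UniqueDiffOn ℝ (unitCube p) := by
  rw [unitCube, ← Set.pi_univ_Icc]
  exact UniqueDiffOn.univ_pi fun _ => uniqueDiffOn_Icc one_pos

theorem Hclass.abs_le_one (hf : f ∈ Hclass p β) {x : Fin p → ℝ} (hx : x ∈ unitCube p) :
    |f x| ≤ 1 := hf.2 [] (by simp) x hx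

theorem Hclass.pderivW_mem (hf : f ∈ Hclass p (β + 1)) (i : Fin p) :
    pderivW p i f ∈ Hclass p β := by
  refine ⟨?_, fun ls hls => hf.2 (i :: ls) (by simpa using hls)⟩
  have := hf.1.fderivWithin (m := β) (uniqueDiffOn_unitCube p) (by norm_cast)
  exact this.clm_apply contDiffOn_const

theorem fderivWithin_eq_sum_pderivW (x v : Fin p → ℝ) :
    fderivWithin ℝ f (unitCube p) x v = ∑ i, v i * pderivW p i f x := by
  conv_lhs => rw [pi_eq_sum_univ' v]
  simp [pderivW, map_sum]

/-- Iterated directional derivative, expanded in partial derivatives. -/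
noncomputable def dirDeriv (v : Fin p → ℝ) : ℕ → ((Fin p → ℝ) → ℝ) → (Fin p → ℝ) → ℝ
  | 0, f, x => f x
  | k + 1, f, x => ∑ i, v i * dirDeriv v k (pderivW p i f) x

theorem Hclass.mono {β' : ℕ} (hf : f ∈ Hclass p β) (h : β' ≤ β) : f ∈ Hclass p β' :=
  ⟨hf.1.of_le (by exact_mod_cast h), fun ls hls => hf.2 ls (hls.trans h)⟩

theorem abs_dirDeriv_le (v : Fin p → ℝ) {k : ℕ} (hf : f ∈ Hclass p k) {x : Fin p → ℝ}
    (hx : x ∈ unitCube p) : |dirDeriv v k f x| ≤ (∑ i, |v i|) ^ k := by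
  induction k generalizing f with
  | zero => simpa [dirDeriv] using Hclass.abs_le_one hf hx
  | succ k ih =>
    rw [dirDeriv, pow_succ', Finset.sum_mul]
    refine (Finset.abs_sum_le_sum_abs _ _).trans (Finset.sum_le_sum fun i _ => ?_)
    rw [abs_mul]
    exact mul_le_mul_of_nonneg_left (ih (Hclass.pderivW_mem hf i)) (abs_nonneg _)

theorem hasDerivWithinAt_dirDeriv {x₀ v : Fin p → ℝ}
    (hseg : ∀ t ∈ Set.Icc (0 : ℝ) 1, x₀ + t • v ∈ unitCube p) {k : ℕ}
    (hf : f ∈ Hclass p (k + 1)) {t : ℝ} (ht : t ∈ Set.Icc (0 : ℝ) 1) :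
    HasDerivWithinAt (fun t : ℝ => dirDeriv v k f (x₀ + t • v))
      (dirDeriv v (k + 1) f (x₀ + t • v)) (Set.Icc 0 1) t := by
  induction k generalizing f with
  | zero =>
    have h1 : HasFDerivWithinAt f (fderivWithin ℝ f (unitCube p) (x₀ + t • v)) (unitCube p)
        (x₀ + t • v) :=
      ((hf.1.differentiableOn (by simp)) _ (hseg t ht)).hasFDerivWithinAt
    have h2 : HasDerivWithinAt (fun t : ℝ => x₀ + t • v) v (Set.Icc 0 1) t := by
      simpa using (((hasDerivAt_id t).smul_const v).const_add x₀).hasDerivWithinAt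
    have := h1.comp_hasDerivWithinAt t h2 hseg
    rw [fderivWithin_eq_sum_pderivW] at this
    exact this
  | succ k ih =>
    simp only [dirDeriv]
    exact HasDerivWithinAt.fun_sum fun i _ => (ih (Hclass.pderivW_mem hf i)).const_mul (v i)

theorem abs_sub_taylor_dirDeriv_le (hf : f ∈ Hclass p β) {x₀ x : Fin p → ℝ}
    (hx₀ : x₀ ∈ unitCube p) (hx : x ∈ unitCube p) {ρ : ℝ} (hρ : ∀ i, |x i - x₀ i| ≤ ρ) :
    |f x - ∑ k ∈ Finset.range β, dirDeriv (x - x₀) k f x₀ / k.factorial|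
      ≤ (p * ρ) ^ β / β.factorial := by
  have hseg : ∀ t ∈ Set.Icc (0 : ℝ) 1, x₀ + t • (x - x₀) ∈ unitCube p := fun t ht =>
    (convex_Icc 0 1).add_smul_sub_mem hx₀ hx ht
  have hsum : ∑ i, |(x - x₀) i| ≤ p * ρ := by
    calc _ ≤ ∑ _i : Fin p, ρ := Finset.sum_le_sum fun i _ => hρ i
      _ = p * ρ := by simp
  have := abs_sub_taylor_le (n := β) (M := (p * ρ) ^ β)
    (G := fun k t => dirDeriv (x - x₀) k f (x₀ + t • (x - x₀)))
    (fun k hk t ht => hasDerivWithinAt_dirDeriv hseg (Hclass.mono hf hk) ht)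
    (fun t ht => (abs_dirDeriv_le _ hf (hseg t ht)).trans
      (pow_le_pow_left₀ (Finset.sum_nonneg fun _ _ => abs_nonneg _) hsum _)) 1 (by simp)
  simpa [dirDeriv, div_eq_mul_inv] using this

theorem abs_sub_le_of_mem_Hclass (hβ : 0 < β) (hf : f ∈ Hclass p β) {x y : Fin p → ℝ}
    (hx : x ∈ unitCube p) (hy : y ∈ unitCube p) {ρ : ℝ} (hρ : ∀ i, |x i - y i| ≤ ρ) :
    |f x - f y| ≤ p * ρ := by
  simpa [dirDeriv] using abs_sub_taylor_dirDeriv_le (Hclass.mono hf hβ) hy hx hρ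

end Taylor

section TaylorPolynomial

open MvPolynomial

variable {p β : ℕ} {f : (Fin p → ℝ) → ℝ}

/-- The homogeneous Taylor polynomial of degree `k` at `x₀`, without the factor `1 / k!`. -/
noncomputable def taylorForm (x₀ : Fin p → ℝ) :
    ℕ → ((Fin p → ℝ) → ℝ) → MvPolynomial (Fin p) ℝ
  | 0, f => C (f x₀)
  | k + 1, f => ∑ i, X i * taylorForm x₀ k (pderivW p i f)

theorem eval_taylorForm (x₀ v : Fin p → ℝ) (k : ℕ) (f : (Fin p → ℝ) → ℝ) :
    eval v (taylorForm x₀ k f) = dirDeriv v k f x₀ := by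
  induction k generalizing f with
  | zero => simp [taylorForm, dirDeriv]
  | succ k ih => simp [taylorForm, dirDeriv, ih]

theorem abs_coeff_taylorForm_le {x₀ : Fin p → ℝ} (hx₀ : x₀ ∈ unitCube p) {k : ℕ}
    (hf : f ∈ Hclass p k) (α : Fin p →₀ ℕ) :
    |coeff α (taylorForm x₀ k f)| ≤ coeff α ((∑ i, X i : MvPolynomial (Fin p) ℝ) ^ k) := by
  classical
  induction k generalizing f α with
  | zero =>
    rw [taylorForm, pow_zero, coeff_C, coeff_one]
    split_ifs
    · exact Hclass.abs_le_one hf hx₀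
    · simp
  | succ k ih =>
    rw [taylorForm, pow_succ', Finset.sum_mul, coeff_sum, coeff_sum]
    refine (Finset.abs_sum_le_sum_abs _ _).trans (Finset.sum_le_sum fun i _ => ?_)
    rw [coeff_X_mul', coeff_X_mul']
    split_ifs
    · exact ih (Hclass.pderivW_mem hf i) _
    · simp

/-- A polynomial dominating the Taylor polynomials of functions with partial derivatives bounded
by one. -/
noncomputable def taylorMajorant (p β : ℕ) : MvPolynomial (Fin p) ℝ :=
  ∑ k ∈ Finset.range β, C ((k.factorial : ℝ)⁻¹) * (∑ i, X i) ^ k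

theorem totalDegree_taylorMajorant_le (p β : ℕ) : (taylorMajorant p β).totalDegree ≤ β - 1 := by
  refine totalDegree_finsetSum_le fun k hk => (totalDegree_mul _ _).trans ?_
  rw [totalDegree_C, zero_add]
  refine (totalDegree_pow _ _).trans ?_
  have : (∑ i : Fin p, X i : MvPolynomial (Fin p) ℝ).totalDegree ≤ 1 :=
    totalDegree_finsetSum_le fun i _ => (totalDegree_X i).le
  have := Finset.mem_range.1 hk
  nlinarith [Nat.sub_add_cancel (show 1 ≤ β by omega)]

theorem pow_le_factorial_mul_pow (p k : ℕ) : p ^ k ≤ k.factorial * (k + 1) ^ p := by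
  have key : p ^ k ≤ k.factorial * Nat.choose (p + k) k := by
    rw [← Nat.descFactorial_eq_factorial_mul_choose]
    calc p ^ k ≤ (p + k + 1 - k) ^ k := Nat.pow_le_pow_left (by omega) k
      _ ≤ _ := Nat.pow_sub_le_descFactorial _ _
  refine key.trans (Nat.mul_le_mul_left _ ?_)
  clear key
  induction p with
  | zero => simp
  | succ p ih =>
    have h := Nat.add_one_mul_choose_eq (p + k) p
    have h1 : (p + k).choose p = (p + k).choose k := Nat.choose_symm_add
    have h2 : (p + 1 + k).choose k = (p + k + 1).choose (p + 1) := by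
      rw [show p + k + 1 = p + 1 + k by ring]; exact Nat.choose_symm_add.symm
    rw [h2]
    rw [h1] at h
    have h3 : (p + k + 1).choose (p + 1) * (p + 1) ≤ (k + 1) * (k + 1) ^ p * (p + 1) := by
      rw [← h]
      calc (p + k + 1) * (p + k).choose k ≤ ((k + 1) * (p + 1)) * (k + 1) ^ p := by
            refine Nat.mul_le_mul ?_ ih
            nlinarith
        _ = _ := by ring
    rw [pow_succ']
    exact Nat.le_of_mul_le_mul_right h3 (by omega)

theorem eval_taylorMajorant_le (p β : ℕ) :
    eval (fun _ => 1) (taylorMajorant p β) ≤ (β : ℝ) * ((β : ℝ) + 1) ^ p := by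
  simp only [taylorMajorant, map_sum, map_mul, map_pow, eval_C, eval_X, Finset.sum_const,
    Finset.card_univ, Fintype.card_fin, nsmul_eq_mul, mul_one]
  calc _ ≤ ∑ k ∈ Finset.range β, ((β : ℝ) + 1) ^ p := Finset.sum_le_sum fun k hk => by
        rw [inv_mul_le_iff₀ (by positivity)]
        calc (p : ℝ) ^ k ≤ k.factorial * ((k : ℝ) + 1) ^ p := by
              exact_mod_cast pow_le_factorial_mul_pow p k
          _ ≤ _ := by
            gcongr
            exact (Finset.mem_range.1 hk).le
    _ = _ := by simp

theorem exists_taylor_family (p : ℕ) {β : ℕ} (hβ : 0 < β) :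
    ∃ (ι : Type) (_ : Fintype ι) (ls : ι → List (Fin p)) (M : ι → ℝ),
      Fintype.card ι ≤ β ^ p ∧ (∀ α, (ls α).length ≤ β - 1) ∧ (∀ α, 0 ≤ M α) ∧
      ∑ α, M α ≤ (β : ℝ) * ((β : ℝ) + 1) ^ p ∧
      ∀ f ∈ Hclass p β, ∀ x₀ ∈ unitCube p, ∃ c : ι → ℝ, (∀ α, |c α| ≤ M α) ∧
        ∀ x ∈ unitCube p, ∀ ρ : ℝ, (∀ i, |x i - x₀ i| ≤ ρ) →
          |f x - ∑ α, c α * ((ls α).map fun i => x i - x₀ i).prod|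
            ≤ (p * ρ) ^ β / β.factorial := by
  classical
  have hdeg : ∀ α ∈ (taylorMajorant p β).support, (α.sum fun _ e => e) ≤ β - 1 := fun α hα =>
    (le_totalDegree hα).trans (totalDegree_taylorMajorant_le p β)
  have hcoeff : ∀ α, 0 ≤ coeff α (taylorMajorant p β) := by
    intro α
    rw [taylorMajorant, coeff_sum]
    refine Finset.sum_nonneg fun k hk => ?_
    clear hk
    rw [coeff_C_mul]
    have h0 : ∀ α : Fin p →₀ ℕ, 0 ≤ coeff α ((∑ i, X i : MvPolynomial (Fin p) ℝ) ^ k) := by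
      induction k with
      | zero => intro α; rw [pow_zero, coeff_one]; split_ifs <;> simp
      | succ k ih =>
        intro α
        rw [pow_succ', Finset.sum_mul, coeff_sum]
        refine Finset.sum_nonneg fun i _ => ?_
        rw [coeff_X_mul']
        split_ifs
        · exact ih _
        · exact le_rfl
    have := h0 α
    positivity
  have hprod : ∀ (α : Fin p →₀ ℕ) (v : Fin p → ℝ),
      ((Finsupp.toMultiset α).toList.map v).prod = ∏ i, v i ^ α i := by
    intro α v
    rw [← Multiset.prod_coe, ← Multiset.map_coe, Multiset.coe_toList, Finsupp.toMultiset_apply,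
      Finsupp.sum, ← Multiset.coe_mapAddMonoidHom, map_sum, Multiset.prod_sum]
    simp only [Multiset.coe_mapAddMonoidHom, Multiset.map_nsmul, Multiset.map_singleton,
      Multiset.prod_nsmul, Multiset.prod_singleton]
    exact Finset.prod_subset (Finset.subset_univ _) fun i _ hi => by
      rw [Finsupp.notMem_support_iff.1 hi, pow_zero]
  refine ⟨(taylorMajorant p β).support, inferInstance,
    fun α => (Finsupp.toMultiset α.1).toList, fun α => coeff α.1 (taylorMajorant p β),
    ?_, ?_, fun α => hcoeff _, ?_, ?_⟩
  · have hlt : ∀ (α : (taylorMajorant p β).support) i, α.1 i < β := fun α i => by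
      have h1 := hdeg α.1 α.2
      rw [Finsupp.sum_fintype _ _ fun _ => rfl] at h1
      have h2 := Finset.single_le_sum (f := fun i => α.1 i) (fun _ _ => Nat.zero_le _)
        (Finset.mem_univ i)
      omega
    calc _ ≤ Fintype.card (Fin p → Fin β) :=
          Fintype.card_le_of_injective (fun α i => ⟨α.1 i, hlt α i⟩) fun α γ h => by
            ext i
            simpa using congrFun h i
      _ = β ^ p := by simp
  · intro α
    rw [Multiset.length_toList, Finsupp.card_toMultiset]
    exact hdeg α.1 α.2
  · refine le_of_eq_of_le ?_ (eval_taylorMajorant_le p β)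
    rw [eval_eq']
    simp only [one_pow, Finset.prod_const_one, mul_one]
    exact Finset.sum_coe_sort (taylorMajorant p β).support fun α => coeff α (taylorMajorant p β)
  · intro f hf x₀ hx₀
    set P : MvPolynomial (Fin p) ℝ :=
      ∑ k ∈ Finset.range β, C ((k.factorial : ℝ)⁻¹) * taylorForm x₀ k f with hP
    have hdom : ∀ α, |coeff α P| ≤ coeff α (taylorMajorant p β) := by
      intro α
      rw [hP, taylorMajorant, coeff_sum, coeff_sum]
      refine (Finset.abs_sum_le_sum_abs _ _).trans (Finset.sum_le_sum fun k hk => ?_)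
      rw [coeff_C_mul, coeff_C_mul, abs_mul, abs_of_nonneg (by positivity)]
      exact mul_le_mul_of_nonneg_left (abs_coeff_taylorForm_le hx₀
        (Hclass.mono hf (Finset.mem_range.1 hk).le) α) (by positivity)
    refine ⟨fun α => coeff α.1 P, fun α => hdom _, fun x hx ρ hρ => ?_⟩
    refine le_of_eq_of_le ?_ (abs_sub_taylor_dirDeriv_le hf hx₀ hx hρ)
    congr 2
    calc _ = eval (x - x₀) P := by
          rw [eval_eq']
          simp only [hprod, Pi.sub_apply]
          rw [Finset.sum_coe_sort (taylorMajorant p β).support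
            fun α => coeff α P * ∏ i, (x i - x₀ i) ^ α i]
          refine (Finset.sum_subset (fun α hα => ?_) fun α _ hα => ?_).symm
          · rw [mem_support_iff] at hα ⊢
            intro h0
            have := hdom α
            rw [h0] at this
            exact hα (abs_nonpos_iff.1 this)
          · rw [notMem_support_iff.1 hα, zero_mul]
      _ = _ := by
        rw [hP, map_sum]
        refine Finset.sum_congr rfl fun k _ => ?_
        rw [map_mul, eval_C, eval_taylorForm, div_eq_inv_mul]

end TaylorPolynomial

section Network

theorem exists_nat_quantize {B : ℕ} (hB : 0 < B) {t : ℝ} (h0 : 0 ≤ t) (h1 : t ≤ 1) :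
    ∃ v : ℕ, v < B ∧ |(v : ℝ) / B - t| ≤ 1 / B := by
  have hB' : (0 : ℝ) < B := by exact_mod_cast hB
  have htB : 0 ≤ t * B := by positivity
  have hle : t * B ≤ B := by nlinarith
  refine ⟨min ⌊t * B⌋₊ (B - 1), by omega, ?_⟩
  have h2 : ((min ⌊t * B⌋₊ (B - 1) : ℕ) : ℝ) ≤ t * B :=
    le_trans (by exact_mod_cast min_le_left _ _) (Nat.floor_le htB)
  have h3 : t * B - 1 ≤ ((min ⌊t * B⌋₊ (B - 1) : ℕ) : ℝ) := by
    rcases min_choice ⌊t * B⌋₊ (B - 1) with h | h <;> rw [h]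
    · linarith [Nat.lt_floor_add_one (t * B)]
    · rw [Nat.cast_sub hB]; push_cast; linarith
  rw [abs_le]
  constructor
  · rw [le_sub_iff_add_le, le_div_iff₀ hB']
    have : (-(1 / (B : ℝ)) + t) * B = t * B - 1 := by field_simp; ring
    linarith
  · rw [sub_le_iff_le_add, div_le_iff₀ hB']
    have : (1 / (B : ℝ) + t) * B = t * B + 1 := by field_simp; ring
    linarith

theorem abs_list_prod_le_one {α : Type*} (l : List α) {g : α → ℝ} (h : ∀ a, |g a| ≤ 1) :
    |(l.map g).prod| ≤ 1 := by
  induction l with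
  | nil => simp
  | cons a l ih =>
    rw [List.map_cons, List.prod_cons, abs_mul]
    exact mul_le_one₀ (h a) (abs_nonneg _) ih

/-- Networks of prescribed size approximating smooth functions outside of a small neighbourhood of
the discontinuities of a grid. -/
theorem exists_computes_on_grid {p β N b ℓ e n κ W : ℕ} (hp : 0 < p) (hβ : 0 < β) (hNb : N < b)
    (hN : 0 < N) (hℓ : 0 < ℓ) (he : N * ℓ ≤ b ^ e) (hκ : 0 < κ)
    (hK : (κ + 1) ^ p ≤ N * ℓ * (N * ℓ)) (hW1 : p * (2 * b) ≤ W) (hW2 : 2 * b + 5 + p ≤ W)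
    {f : (Fin p → ℝ) → ℝ} (hf : f ∈ Hclass p β) {η : ℝ} (hη : 0 < η) :
    ∃ φ : {x : unitCube p // ∀ i, Int.fract (((κ * b ^ n : ℕ) : ℝ) * x.1 i) ≤ 1 - η} → ℝ,
      Computes (β ^ p * W) (10 * e + n + ℓ * (n + 3) + 2 * n * (β - 1))
        (Set.range fun (i : Fin p) x => x.1.1 i) {φ} ∧
      ∀ x, |φ x - f x.1.1| ≤ p * (1 / ((κ * b ^ n : ℕ) : ℝ)) + (p * (1 / (κ : ℝ))) ^ β / β.factorial
        + 2 / ((b ^ n : ℕ) : ℝ) * (β * ((β : ℝ) + 1) ^ p) := by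
  obtain ⟨ι, _, ls, M, hcard, hls, hM0, hMsum, hT⟩ := exists_taylor_family p hβ
  set B : ℕ := b ^ n with hB
  have hB0 : 0 < B := by rw [hB]; exact Nat.pow_pos (by omega)
  have hBR : (0 : ℝ) < (B : ℝ) := by exact_mod_cast hB0
  have hκR : (0 : ℝ) < (κ : ℝ) := by exact_mod_cast hκ
  set Q : ℕ := κ * B with hQ
  have hQR : (0 : ℝ) < (Q : ℝ) := by exact_mod_cast Nat.mul_pos hκ hB0
  have hQc : (Q : ℝ) = κ * B := by rw [hQ]; push_cast; ring
  let x₀ : (Fin p → Fin (κ + 1)) → Fin p → ℝ := fun k i => (k i : ℕ) / (κ : ℝ)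
  have hx₀ : ∀ k, x₀ k ∈ unitCube p := fun k => by
    refine ⟨fun i => by simp only [x₀, Pi.zero_apply]; positivity, fun i => ?_⟩
    simp only [x₀, Pi.one_apply]
    rw [div_le_one hκR]
    exact_mod_cast Nat.le_of_lt_succ (k i).2
  choose c hcM hc using fun k => hT f hf (x₀ k) (hx₀ k)
  have hvex : ∀ α k, ∃ v : ℕ, v < B ∧ |M α * (2 * ((v : ℝ) / B) - 1) - c k α| ≤ M α * (2 / B) := by
    intro α k
    have h1 := abs_le.1 (hcM k α)
    rcases (hM0 α).eq_or_lt with h0 | h0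
    · refine ⟨0, hB0, ?_⟩
      rw [← h0] at h1 ⊢
      have : c k α = 0 := by linarith
      simp [this]
    · obtain ⟨v, hv, hv'⟩ := exists_nat_quantize hB0 (t := (c k α / M α + 1) / 2)
        (by
          have : -1 ≤ c k α / M α := by rw [le_div_iff₀ h0]; linarith
          linarith)
        (by
          have : c k α / M α ≤ 1 := by rw [div_le_iff₀ h0]; linarith
          linarith)
      refine ⟨v, hv, ?_⟩
      have e1 : M α * (2 * ((v : ℝ) / B) - 1) - c k α
          = M α * (2 * ((v : ℝ) / B - (c k α / M α + 1) / 2)) := by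
        field_simp
        ring
      rw [e1, abs_mul, abs_mul, abs_of_pos h0, abs_two]
      refine mul_le_mul_of_nonneg_left ?_ h0.le
      calc 2 * |(v : ℝ) / B - (c k α / M α + 1) / 2| ≤ 2 * (1 / B) := by gcongr
        _ = 2 / B := by ring
  choose v hvB hvM using hvex
  let Y := {x : unitCube p // ∀ i, Int.fract ((Q : ℝ) * x.1 i) ≤ 1 - η}
  let I : Y → Fin p → ℕ := fun x i => ⌊(Q : ℝ) * x.1.1 i⌋₊
  have hx0 : ∀ (x : Y) i, 0 ≤ (Q : ℝ) * x.1.1 i := fun x i => mul_nonneg hQR.le (x.1.2.1 i)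
  have hIle : ∀ (x : Y) i, (I x i : ℝ) ≤ (Q : ℝ) * x.1.1 i := fun x i => Nat.floor_le (hx0 x i)
  have hIQ : ∀ (x : Y) i, I x i ≤ Q := fun x i => by
    have h1 : x.1.1 i ≤ 1 := x.1.2.2 i
    have h2 := hIle x i
    have : (I x i : ℝ) ≤ Q := by nlinarith
    exact_mod_cast this
  let q : Y → Fin p → Fin (κ + 1) := fun x i => ⟨I x i / B, by
    rw [Nat.div_lt_iff_lt_mul hB0]
    calc I x i ≤ κ * B := hIQ x i
      _ < (κ + 1) * B := Nat.mul_lt_mul_of_pos_right (by omega) hB0⟩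
  let u : Fin p → Y → ℕ := fun i x => I x i % B
  have hqu : ∀ (x : Y) i, (q x i : ℕ) * B + u i x = I x i := fun x i => Nat.div_add_mod' _ _
  have huB : ∀ i (x : Y), u i x < B := fun i x => Nat.mod_lt _ hB0
  have hF : ∀ (x : Y) i, (Q : ℝ) * x.1.1 i = (I x i : ℝ) + Int.fract ((Q : ℝ) * x.1.1 i) := by
    intro x i
    have h1 := Int.floor_add_fract ((Q : ℝ) * x.1.1 i)
    rw [← natCast_floor_eq_intCast_floor (hx0 x i)] at h1
    exact h1.symm
  have hcomp := computes_cellPolynomial (n := n) (M := β - 1) (η := η) (c := (Q : ℝ)) hp hNb hN hℓ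
    he hK hW1 hW2 (fun i (x : Y) => x.1.1 i) (fun i x => Int.fract ((Q : ℝ) * x.1.1 i)) q u huB hη
    (fun _ _ => Int.fract_nonneg _) (fun i x => x.2 i)
    (fun i x => by rw [← hB, hqu x i]; exact hF x i) v (fun α k => hvB α k) ls hls
    (fun α => M α * (1 / (κ : ℝ)) ^ (ls α).length)
  refine ⟨_, hcomp.mono_width (Nat.mul_le_mul_right _ hcard), fun x => ?_⟩
  let xt : Fin p → ℝ := fun i => I x i / (Q : ℝ)
  have hxt1 : ∀ i, xt i ≤ x.1.1 i := fun i => by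
    simp only [xt]
    rw [div_le_iff₀ hQR, mul_comm]
    exact hIle x i
  have hxt : xt ∈ unitCube p :=
    ⟨fun i => by simp only [xt, Pi.zero_apply]; positivity,
      fun i => (hxt1 i).trans (x.1.2.2 i)⟩
  have hclose : ∀ i, |xt i - x.1.1 i| ≤ 1 / (Q : ℝ) := fun i => by
    rw [abs_sub_comm, abs_of_nonneg (sub_nonneg.2 (hxt1 i))]
    simp only [xt]
    rw [sub_le_iff_le_add, ← add_div, le_div_iff₀ hQR]
    have := hF x i
    linarith [Int.fract_lt_one ((Q : ℝ) * x.1.1 i)]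
  have hdiff : ∀ i, xt i - x₀ (q x) i = 1 / (κ : ℝ) * ((u i x : ℝ) / B) := fun i => by
    simp only [xt, x₀]
    rw [← hqu x i, hQc]
    push_cast
    field_simp
    ring
  have hu1 : ∀ i, (u i x : ℝ) / B ≤ 1 := fun i => by
    rw [div_le_one hBR]
    exact_mod_cast (huB i x).le
  have hρ : ∀ i, |xt i - x₀ (q x) i| ≤ 1 / (κ : ℝ) := fun i => by
    rw [hdiff, abs_of_nonneg (by positivity)]
    exact mul_le_of_le_one_right (by positivity) (hu1 i)
  have hρ1 : ∀ i, |xt i - x₀ (q x) i| ≤ 1 := fun i => (hρ i).trans (by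
    rw [div_le_one hκR]; exact_mod_cast hκ)
  have hprod : ∀ l : List (Fin p), (l.map fun i => xt i - x₀ (q x) i).prod
      = (1 / (κ : ℝ)) ^ l.length * (l.map fun i => (u i x : ℝ) / B).prod := by
    intro l
    simp only [hdiff]
    rw [List.prod_map_mul]
    simp
  have h1 := hc (q x) xt hxt _ hρ
  have h2 := abs_sub_le_of_mem_Hclass hβ hf hxt x.1.2 hclose
  have hBn : ((b : ℝ) ^ n) = (B : ℝ) := by rw [hB]; push_cast; rfl
  simp only [hBn]
  set φ : ℝ := ∑ α, M α * (1 / (κ : ℝ)) ^ (ls α).length * ((2 * ((v α (q x) : ℝ) / (B : ℝ)) - 1)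
        * ((ls α).map fun i => (u i x : ℝ) / (B : ℝ)).prod) with hφ
  have h3 : |φ - ∑ α, c (q x) α * ((ls α).map fun i => xt i - x₀ (q x) i).prod|
      ≤ 2 / (B : ℝ) * (β * ((β : ℝ) + 1) ^ p) := by
    rw [hφ, ← Finset.sum_sub_distrib]
    calc _ ≤ ∑ α, M α * (2 / (B : ℝ)) := by
          refine (Finset.abs_sum_le_sum_abs _ _).trans (Finset.sum_le_sum fun α _ => ?_)
          have e1 : M α * (1 / (κ : ℝ)) ^ (ls α).length * ((2 * ((v α (q x) : ℝ) / (B : ℝ)) - 1)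
              * ((ls α).map fun i => (u i x : ℝ) / (B : ℝ)).prod)
              - c (q x) α * ((ls α).map fun i => xt i - x₀ (q x) i).prod
              = (M α * (2 * ((v α (q x) : ℝ) / (B : ℝ)) - 1) - c (q x) α)
                * ((ls α).map fun i => xt i - x₀ (q x) i).prod := by
            rw [hprod]; ring
          rw [e1, abs_mul]
          exact (mul_le_of_le_one_right (abs_nonneg _) (abs_list_prod_le_one _ hρ1)).trans
            (hvM α (q x))
      _ = 2 / (B : ℝ) * ∑ α, M α := by rw [← Finset.sum_mul, mul_comm]
      _ ≤ _ := by gcongr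
  rw [abs_le] at h1 h2 h3 ⊢
  constructor <;> linarith

/-- Networks of prescribed size approximating smooth functions on the unit cube. -/
theorem exists_computes_approx {p β N b ℓ e n κ W : ℕ} (hp : 0 < p) (hβ : 0 < β) (hNb : N < b)
    (hN : 0 < N) (hℓ : 0 < ℓ) (he : N * ℓ ≤ b ^ e) (hκ : 0 < κ)
    (hK : (κ + 1) ^ p ≤ N * ℓ * (N * ℓ)) (hW1 : p * (2 * b) ≤ W) (hW2 : 2 * b + 5 + p ≤ W)
    {f : (Fin p → ℝ) → ℝ} (hf : f ∈ Hclass p β) {δ : ℝ} (hδ : 0 < δ) :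
    ∃ ψ : unitCube p → ℝ,
      Computes (3 ^ p * (β ^ p * W)) (10 * e + n + ℓ * (n + 3) + 2 * n * (β - 1) + 3 * p)
        (Set.range fun (i : Fin p) (x : unitCube p) => x.1 i) {ψ} ∧
      ∀ x, |ψ x - f x.1| ≤ p * (1 / ((κ * b ^ n : ℕ) : ℝ)) + (p * (1 / (κ : ℝ))) ^ β / β.factorial
        + 2 / ((b ^ n : ℕ) : ℝ) * (β * ((β : ℝ) + 1) ^ p) + δ := by
  have hβp : 0 < β ^ p := Nat.pow_pos hβ
  have hQ : 0 < κ * b ^ n := Nat.mul_pos hκ (Nat.pow_pos (by omega))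
  refine exists_computes_of_grid (f := fun x => f x.1) (K := p) (Q := ((κ * b ^ n : ℕ) : ℝ)) ?_
    (by positivity) (by exact_mod_cast hQ) hδ
    (fun ρ x y h => abs_sub_le_of_mem_Hclass hβ hf x.2 y.2 h) fun η hη _ =>
      exists_computes_on_grid hp hβ hNb hN hℓ he hκ hK hW1 hW2 hf hη
  exact le_trans (by omega : 2 ≤ W) (Nat.le_mul_of_pos_left _ hβp)

end Network

/-- The error terms of the localized Taylor approximation in terms of the number of cells. -/
theorem taylor_error_le {p β κ B : ℕ} (hp : 0 < p) (hβ : 0 < β) (hκ : 0 < κ) {Z : ℝ}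
    (hZ : 1 ≤ Z) (hκZ : Z ^ (2 / (p : ℝ)) ≤ 8 * κ) (hB : Z ^ (2 * β) ≤ B) :
    p * (1 / ((κ * B : ℕ) : ℝ)) + (p * (1 / (κ : ℝ))) ^ β / β.factorial
        + 2 / (B : ℝ) * (β * ((β : ℝ) + 1) ^ p)
      ≤ 85 * ((β : ℝ) + 1) ^ p * 8 ^ β * Z ^ (-(2 * (β : ℝ)) / (p : ℝ)) := by
  have hZ0 : 0 < Z := by linarith
  have hpR : (1 : ℝ) ≤ p := by exact_mod_cast hp
  have hκR : (1 : ℝ) ≤ κ := by exact_mod_cast hκ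
  have hE : Z ^ (-(2 * (β : ℝ)) / (p : ℝ)) = ((Z ^ (2 / (p : ℝ))) ^ β)⁻¹ := by
    rw [← Real.rpow_natCast, ← Real.rpow_mul hZ0.le, ← Real.rpow_neg hZ0.le]
    congr 1
    ring
  set E := Z ^ (-(2 * (β : ℝ)) / (p : ℝ)) with hEdef
  have hE0 : 0 < E := Real.rpow_pos_of_pos hZ0 _
  have hBpos : (0 : ℝ) < B := lt_of_lt_of_le (by positivity) hB
  have hBE : 1 / (B : ℝ) ≤ E := by
    calc 1 / (B : ℝ) ≤ 1 / Z ^ (2 * β) := by gcongr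
      _ = Z ^ (-(2 * (β : ℝ))) := by
          rw [Real.rpow_neg hZ0.le, one_div]
          norm_cast
      _ ≤ E := by
          refine Real.rpow_le_rpow_of_exponent_le hZ ?_
          rw [le_div_iff₀ (by positivity)]
          nlinarith [Nat.cast_nonneg (α := ℝ) β]
  have hκE : (1 / (κ : ℝ)) ^ β ≤ 8 ^ β * E := by
    have hX : 0 < Z ^ (2 / (p : ℝ)) := Real.rpow_pos_of_pos hZ0 _
    rw [hE, ← inv_pow, ← mul_pow]
    gcongr
    rw [← div_eq_mul_inv, div_le_div_iff₀ (by positivity) hX]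
    linarith
  set P : ℝ := ((β : ℝ) + 1) ^ p with hP
  have hβR : (1 : ℝ) ≤ β := by exact_mod_cast hβ
  have hpP : (p : ℝ) ≤ P := by
    have h1 : (p : ℝ) ≤ 2 ^ p := by exact_mod_cast Nat.lt_two_pow_self.le
    exact h1.trans (pow_le_pow_left₀ (by norm_num) (by linarith) p)
  have hP1 : 1 ≤ P := hpR.trans hpP
  have hβ8 : (β : ℝ) ≤ 8 ^ β := by exact_mod_cast (Nat.lt_pow_self (by norm_num)).le
  have h81 : (1 : ℝ) ≤ 8 ^ β := hβR.trans hβ8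
  have hfac : (p : ℝ) ^ β / β.factorial ≤ P := by
    rw [div_le_iff₀ (by positivity), mul_comm, hP]
    exact_mod_cast pow_le_factorial_mul_pow p β
  have hPE : P * E ≤ P * 8 ^ β * E := by
    gcongr
    exact le_mul_of_one_le_right (by linarith) h81
  have t1 : p * (1 / ((κ * B : ℕ) : ℝ)) ≤ P * E := by
    push_cast
    gcongr
    refine le_trans ?_ hBE
    gcongr
    exact le_mul_of_one_le_left hBpos.le hκR
  have t2 : (p * (1 / (κ : ℝ))) ^ β / β.factorial ≤ P * (8 ^ β * E) := by
    rw [mul_pow, mul_div_right_comm]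
    gcongr
  have t3 : 2 / (B : ℝ) * (β * P) ≤ 2 * E * (8 ^ β * P) := by
    have : 2 / (B : ℝ) ≤ 2 * E := by
      rw [← mul_one_div]
      gcongr
    gcongr
  have : 0 < P * 8 ^ β * E := by positivity
  linarith

/-- Splitting a depth budget between the number of cells treated in one pass and the number of
digits needed to address them. -/
theorem exists_depth_split {β L : ℕ} {D : ℝ} (hβ : 0 < β) (hD : 108 * (β : ℝ) ^ 2 ≤ D)
    (hDL : D ≤ L) :
    ∃ ℓ e : ℕ, 0 < ℓ ∧ 0 < e ∧ ℓ ≤ 2 ^ (e - 1) ∧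
      D / (72 * (β : ℝ) ^ 2 * Real.log (4 * (L : ℝ))) ≤ 12 * ℓ ∧
      108 * (β : ℝ) ^ 2 * (ℓ * e) ≤ D := by
  have hβR : (1 : ℝ) ≤ (β : ℝ) ^ 2 := one_le_pow₀ (by exact_mod_cast hβ)
  have hL : (108 : ℝ) ≤ L := by linarith
  have hlog : 1 ≤ Real.log (4 * (L : ℝ)) := by
    rw [Real.le_log_iff_exp_le (by linarith)]
    linarith [Real.exp_one_lt_d9]
  set lg := Real.log (4 * (L : ℝ)) with hlg
  set Λ := D / (72 * (β : ℝ) ^ 2 * lg) with hΛ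
  have hDΛ : D = 72 * (β : ℝ) ^ 2 * lg * Λ := by rw [hΛ]; field_simp
  rcases le_or_gt Λ 12 with h12 | h12
  · exact ⟨1, 1, by norm_num, by norm_num, by norm_num, by simpa using h12, by simpa using hD⟩
  have hceil : (⌈Λ / 12⌉₊ : ℝ) < Λ / 12 + 1 := Nat.ceil_lt_add_one (by linarith)
  have hle : Λ / 12 ≤ ⌈Λ / 12⌉₊ := Nat.le_ceil _
  set ℓ := ⌈Λ / 12⌉₊ with hℓ
  have hℓ0 : 0 < ℓ := Nat.ceil_pos.2 (by linarith)
  have hℓL : (ℓ : ℝ) ≤ L := by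
    have : Λ ≤ D := by
      rw [hΛ]
      refine div_le_self (by linarith) ?_
      nlinarith
    linarith
  refine ⟨ℓ, Nat.log 2 ℓ + 2, hℓ0, by omega, ?_, by linarith, ?_⟩
  · exact (Nat.lt_pow_succ_log_self (by norm_num) ℓ).le
  have he : ((Nat.log 2 ℓ + 2 : ℕ) : ℝ) ≤ 2 * lg := by
    have h1 : 2 ^ (Nat.log 2 ℓ + 2) ≤ 4 * ℓ := by
      have := Nat.pow_log_le_self 2 hℓ0.ne'
      rw [pow_add]; omega
    have h2 : (2 : ℝ) ^ (Nat.log 2 ℓ + 2) ≤ 4 * L :=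
      le_trans (b := 4 * (ℓ : ℝ)) (by exact_mod_cast h1) (by gcongr)
    have h3 := Real.log_le_log (by positivity) h2
    rw [Real.log_pow] at h3
    have h4 := Real.log_two_gt_d9
    have h5 : (0 : ℝ) ≤ ((Nat.log 2 ℓ + 2 : ℕ) : ℝ) := Nat.cast_nonneg _
    nlinarith
  have h6 : (ℓ : ℝ) ≤ Λ / 6 := by linarith
  calc 108 * (β : ℝ) ^ 2 * (ℓ * ((Nat.log 2 ℓ + 2 : ℕ) : ℝ))
      ≤ 108 * (β : ℝ) ^ 2 * (Λ / 6 * (2 * lg)) := by gcongr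
    _ ≤ D := by
      rw [hDΛ]
      have : 0 ≤ (β : ℝ) ^ 2 * lg * Λ := by positivity
      nlinarith

/-- A lower bound for the number of units available after fixing the overhead `c`. -/
theorem twelve_mul_div_log_le_div {c r : ℕ} (hc : 51 ≤ c) (hcr : c ≤ r) :
    12 * ((r : ℝ) / (4 * c * Real.log (8 * (r : ℝ) + 8))) ≤ ((r / c : ℕ) : ℝ) := by
  have hc0 : 0 < c := by omega
  have hcR : (0 : ℝ) < c := by exact_mod_cast hc0
  have hr : (51 : ℝ) ≤ r := by exact_mod_cast hc.trans hcr
  have hlog : 6 ≤ Real.log (8 * (r : ℝ) + 8) := by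
    rw [Real.le_log_iff_exp_le (by linarith)]
    have h1 : Real.exp 6 = Real.exp 1 ^ 6 := by rw [← Real.exp_nat_mul]; norm_num
    have h2 : Real.exp 1 ^ 6 ≤ 2.7183 ^ 6 :=
      pow_le_pow_left₀ (Real.exp_pos 1).le (by linarith [Real.exp_one_lt_d9]) 6
    have h3 : (2.7183 : ℝ) ^ 6 ≤ 416 := by norm_num
    linarith
  have hN : 1 ≤ r / c := (Nat.one_le_div_iff hc0).2 hcr
  have hrN : r < c * (r / c + 1) := by
    rw [mul_comm]
    exact Nat.lt_mul_of_div_lt (Nat.lt_succ_self _) hc0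
  have hrN' : (r : ℝ) ≤ c * (2 * ((r / c : ℕ) : ℝ)) := by
    exact_mod_cast hrN.le.trans (Nat.mul_le_mul_left _ (by omega))
  have h0 : (0 : ℝ) ≤ ((r / c : ℕ) : ℝ) := Nat.cast_nonneg _
  rw [← mul_div_assoc, div_le_iff₀ (by positivity)]
  have : (c : ℝ) * ((r / c : ℕ) : ℝ) * 6
      ≤ c * ((r / c : ℕ) : ℝ) * Real.log (8 * (r : ℝ) + 8) := by gcongr
  nlinarith

theorem depth_bound {β ℓ e p L : ℕ} (hβ : 0 < β) (hℓ : 0 < ℓ) (he : 0 < e)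
    (h : 108 * β ^ 2 * (ℓ * e) + 3 * p ≤ L) :
    10 * e + 2 * β * e + ℓ * (2 * β * e + 3) + 2 * (2 * β * e) * (β - 1) + 3 * p + 1 ≤ L := by
  obtain ⟨γ, rfl⟩ := Nat.exists_eq_add_of_lt hβ
  obtain ⟨m, rfl⟩ := Nat.exists_eq_add_of_lt hℓ
  obtain ⟨k, rfl⟩ := Nat.exists_eq_add_of_lt he
  simp only [Nat.zero_add, Nat.add_sub_cancel] at h ⊢
  refine le_trans ?_ h
  ring_nf
  nlinarith [Nat.zero_le (γ * m * k), Nat.zero_le (γ ^ 2 * m * k), Nat.zero_le (γ ^ 2 * m),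
    Nat.zero_le (γ ^ 2 * k), Nat.zero_le (γ * m), Nat.zero_le (γ * k), Nat.zero_le (m * k),
    Nat.zero_le (γ ^ 2)]

theorem rpow_two_div_pow {Z : ℝ} (hZ : 0 ≤ Z) {p : ℕ} (hp : 0 < p) :
    (Z ^ (2 / (p : ℝ))) ^ p = Z * Z := by
  have : (p : ℝ) ≠ 0 := by positivity
  rw [← Real.rpow_natCast, ← Real.rpow_mul hZ, div_mul_cancel₀ _ this, ← sq]
  norm_cast

/-- Smooth functions are approximated by networks with given width and depth budgets. -/
theorem exists_computes_of_budget {p β r L N ℓ e : ℕ} (hp : 0 < p) (hβ : 0 < β) (hN : 0 < N)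
    (hr : 17 * β ^ (p + 1) * 3 ^ p * p * N ≤ r) (hℓ : 0 < ℓ) (he : 0 < e)
    (hle : ℓ ≤ 2 ^ (e - 1)) (hL : 108 * β ^ 2 * (ℓ * e) + 3 * p ≤ L)
    {f : (Fin p → ℝ) → ℝ} (hf : f ∈ Hclass p β) {δ : ℝ} (hδ : 0 < δ) :
    ∃ (n : ℕ) (φ : unitCube p → ℝ), n + 1 ≤ L ∧
      Computes r n (Set.range fun (i : Fin p) (x : unitCube p) => x.1 i) {φ} ∧
      ∀ x, |φ x - f x.1| ≤
        85 * ((β : ℝ) + 1) ^ p * 8 ^ β * ((N * ℓ : ℕ) : ℝ) ^ (-(2 * (β : ℝ)) / (p : ℝ)) + δ := by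
  have hdepth := depth_bound hβ hℓ he hL
  have hZ : (1 : ℝ) ≤ ((N * ℓ : ℕ) : ℝ) := by exact_mod_cast Nat.mul_pos hN hℓ
  set Z : ℝ := ((N * ℓ : ℕ) : ℝ) with hZdef
  have hZ0 : 0 < Z := by linarith
  have hX0 : 0 < Z ^ (2 / (p : ℝ)) := Real.rpow_pos_of_pos hZ0 _
  rcases lt_or_ge (Z ^ (2 / (p : ℝ))) 2 with hX | hX
  · refine ⟨0, fun _ => 0, by omega, ?_, fun x => ?_⟩
    · rintro _ rfl
      exact affSpan.const 0
    rw [zero_sub, abs_neg]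
    refine (Hclass.abs_le_one hf x.2).trans ?_
    have hE : Z ^ (-(2 * (β : ℝ)) / (p : ℝ)) = ((Z ^ (2 / (p : ℝ))) ^ β)⁻¹ := by
      rw [← Real.rpow_natCast, ← Real.rpow_mul hZ0.le, ← Real.rpow_neg hZ0.le]
      congr 1
      ring
    have h1 : 1 ≤ 8 ^ β * Z ^ (-(2 * (β : ℝ)) / (p : ℝ)) := by
      rw [hE, ← div_eq_mul_inv, one_le_div (by positivity)]
      exact pow_le_pow_left₀ hX0.le (by linarith) β
    have h2 : (1 : ℝ) ≤ ((β : ℝ) + 1) ^ p :=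
      one_le_pow₀ (by linarith [Nat.cast_nonneg (α := ℝ) β])
    nlinarith
  have hK2 : 2 ≤ ⌊Z ^ (2 / (p : ℝ))⌋₊ := Nat.le_floor (by exact_mod_cast hX)
  obtain ⟨κ, hκ⟩ : ∃ κ, ⌊Z ^ (2 / (p : ℝ))⌋₊ = κ + 1 := ⟨_, (Nat.sub_add_cancel (by omega)).symm⟩
  have hκ0 : 0 < κ := by omega
  have hfloor := Nat.floor_le hX0.le
  have hfloor' := Nat.lt_floor_add_one (Z ^ (2 / (p : ℝ)))
  rw [hκ] at hfloor hfloor'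
  push_cast at hfloor hfloor'
  have hκ1 : (1 : ℝ) ≤ κ := by exact_mod_cast hκ0
  have hNℓ : N * ℓ ≤ (N + 1) ^ e := by
    obtain ⟨k, rfl⟩ : ∃ k, e = k + 1 := ⟨e - 1, by omega⟩
    rw [pow_succ']
    exact Nat.mul_le_mul (by omega) (hle.trans (Nat.pow_le_pow_left (by omega) k))
  have hKp : (κ + 1) ^ p ≤ N * ℓ * (N * ℓ) := by
    have : ((κ : ℝ) + 1) ^ p ≤ Z * Z := by
      rw [← rpow_two_div_pow hZ0.le hp]
      exact pow_le_pow_left₀ (by positivity) hfloor p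
    rw [hZdef] at this
    exact_mod_cast this
  have hpN : p ≤ p * N := Nat.le_mul_of_pos_right p hN
  have hNp : N ≤ p * N := Nat.le_mul_of_pos_left N hp
  obtain ⟨φ, hφ, happrox⟩ := exists_computes_approx (b := N + 1) (n := 2 * β * e)
    (W := 10 * (p * N)) hp hβ (Nat.lt_succ_self N) hN hℓ hNℓ hκ0 hKp (by nlinarith) (by omega)
    hf hδ
  refine ⟨_, φ, hdepth, hφ.mono_width ?_, fun x => (happrox x).trans ?_⟩
  · refine le_trans ?_ hr
    have h1 : 3 ^ p * (β ^ p * (10 * (p * N))) = 10 * (β ^ p * 3 ^ p * p * N) := by ring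
    have h2 : 17 * β ^ (p + 1) * 3 ^ p * p * N = β * (17 * (β ^ p * 3 ^ p * p * N)) := by ring
    rw [h1, h2]
    exact (Nat.mul_le_mul_right _ (by norm_num)).trans (Nat.le_mul_of_pos_left _ hβ)
  · gcongr
    refine taylor_error_le hp hβ hκ0 hZ (by linarith) ?_
    rw [hZdef]
    have := Nat.pow_le_pow_left hNℓ (2 * β)
    rw [← pow_mul, Nat.mul_comm e] at this
    exact_mod_cast this

end PromptTF

/-- Explicit approximation bound for prompts with embeddings in
`U_{d,r+1} = span{e_1,…,e_{r+1}}`: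
`sup_f inf_{S>0, H^P ∈ Q_{U_{d,r+1}}(T,L,S)} ‖f̂ − f‖_∞
  ≤ C₁·(r/(C₂·log(8r+8)))^{−2β/p}·((L−3p)/(C₃·log(4L)))^{−2β/p}`. -/
theorem statement_9 (p β : ℕ) (hp : 0 < p) (hβ : 0 < β)
    (d : ℕ) (hd : 17 * β ^ (p + 1) * 3 ^ p * p + 1 ≤ d)
    (Θ : List (TFLayer (4 * d + 8))) (hΘ : EmulatesWith d (tfForward Θ) relu)
    (r : ℕ) (hr1 : 17 * β ^ (p + 1) * 3 ^ p * p ≤ r) (hr2 : r ≤ d - 1)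
    (L : ℕ) (hL : 108 * β ^ 2 + 3 * p ≤ L)
    (T : ℕ) (hT : 2 * (r + 1) * L ≤ T) :
    ∀ f ∈ Hclass p β, ∀ δ : ℝ, 0 < δ →
      ∃ (S : ℝ) (T' : ℕ) (u : Fin T' → Fin d → ℝ) (w : Fin T' → ℕ),
        0 < S ∧ 1 ≤ T' ∧ T' ≤ T ∧ ValidPrompt (spanFirst d (r + 1)) T' L u w ∧
        supDist p f (fhat (tfForward Θ) u w S L p)
          ≤ (85 * ((β : ℝ) + 1) ^ p * 8 ^ β) *
              (((r : ℝ) / (68 * (β : ℝ) ^ (p + 1) * 3 ^ p * (p : ℝ)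
                  * Real.log (8 * (r : ℝ) + 8))) ^ (-(2 * (β : ℝ)) / (p : ℝ))) *
              ((((L : ℝ) - 3 * (p : ℝ)) / (72 * (β : ℝ) ^ 2
                  * Real.log (4 * (L : ℝ)))) ^ (-(2 * (β : ℝ)) / (p : ℝ))) + δ := by
  intro f hf δ hδ
  set c := 17 * β ^ (p + 1) * 3 ^ p * p with hc
  have hc51 : 51 * p ≤ c := by
    have h1 : 1 ≤ β ^ (p + 1) := Nat.one_le_pow _ _ hβ
    have h2 : 3 ≤ 3 ^ p := Nat.le_self_pow hp.ne' 3
    calc 51 * p = 17 * 1 * 3 * p := by ring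
      _ ≤ c := by rw [hc]; gcongr
  have hLR : 108 * (β : ℝ) ^ 2 + 3 * p ≤ L := by exact_mod_cast hL
  have hβR : (1 : ℝ) ≤ (β : ℝ) ^ 2 := one_le_pow₀ (by exact_mod_cast hβ)
  have hpR : (0 : ℝ) < p := by exact_mod_cast hp
  obtain ⟨ℓ, e, hℓ, he, hle, hΛ, hD⟩ := exists_depth_split (L := L) (D := (L : ℝ) - 3 * p) hβ
    (by linarith) (by linarith)
  have hR := twelve_mul_div_log_le_div (by omega : 51 ≤ c) hr1
  have hN : 0 < r / c := Nat.div_pos hr1 (by omega)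
  obtain ⟨n, φ, hn, hφ, happrox⟩ := exists_computes_of_budget (r := r) (L := L) hp hβ hN
    (Nat.mul_div_le r c) hℓ he hle (by
      have : 108 * (β : ℝ) ^ 2 * (ℓ * e) + 3 * p ≤ L := by linarith
      exact_mod_cast this) hf hδ
  obtain ⟨S, u, w, hS, hvalid, hfhat⟩ :=
    exists_prompt (by omega) (by omega) (by omega) hn Θ hΘ hφ
  refine ⟨S, _, u, w, hS, ?_, hT, hvalid, ?_⟩
  · exact Nat.mul_pos (by omega) (by omega)
  have : Nonempty (unitCube p) := ⟨⟨0, by simp [unitCube]⟩⟩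
  refine ciSup_le fun x => ?_
  rw [hfhat, abs_sub_comm]
  refine (happrox x).trans ?_
  have hc' : 4 * (c : ℝ) = 68 * (β : ℝ) ^ (p + 1) * 3 ^ p * (p : ℝ) := by
    rw [hc]
    push_cast
    ring
  rw [hc'] at hR
  have hr : (51 : ℝ) ≤ r := by exact_mod_cast (by omega : 51 ≤ r)
  set R := (r : ℝ) / (68 * (β : ℝ) ^ (p + 1) * 3 ^ p * (p : ℝ) * Real.log (8 * (r : ℝ) + 8))
  set Λ := ((L : ℝ) - 3 * (p : ℝ)) / (72 * (β : ℝ) ^ 2 * Real.log (4 * (L : ℝ)))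
  have hR0 : 0 < R := by
    have : 0 < Real.log (8 * (r : ℝ) + 8) := Real.log_pos (by linarith)
    positivity
  have hΛ0 : 0 < Λ := by
    have : 0 < Real.log (4 * (L : ℝ)) := Real.log_pos (by linarith)
    exact div_pos (by linarith) (by positivity)
  rw [mul_assoc _ (R ^ _), ← Real.mul_rpow hR0.le hΛ0.le]
  gcongr ?_ * ?_ + _
  refine Real.rpow_le_rpow_of_nonpos (by positivity) ?_ ?_
  · push_cast
    calc R * Λ ≤ R * (12 * ℓ) := by gcongr
      _ = 12 * R * ℓ := by ring
      _ ≤ _ := by gcongr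
  · exact div_nonpos_of_nonpos_of_nonneg (by linarith [Nat.cast_nonneg (α := ℝ) β]) hpR.le
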